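/- Suppose α is real, a is an integer, q is a positive integer, |α − a/q| ≤ 1/q² and gcd(a,q) = 1. Then for every ε > 0, Σ_{p ≤ N} e(αp²) log p ≪_ε N^{1+ε} ( 1/q + 1/N^{1/2} + q/N² )^{1/4}, where the sum is over primes p ≤ N and e(x) = e^{2πix}. -/

import Mathlib

/-- `e2pi x = e^{2πix}`. -/
noncomputable def e2pi (x : ℝ) : ℂ := Complex.exp (2 * Real.pi * Complex.I * x)

lemma e2pi_add (x y : ℝ) : e2pi (x + y) = e2pi x * e2pi y := by
  simp only [e2pi, ← Complex.exp_add]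
  congr 1
  push_cast
  ring

lemma norm_e2pi (x : ℝ) : ‖e2pi x‖ = 1 := by
  have h : 2 * Real.pi * Complex.I * x = ((2 * Real.pi * x : ℝ) : ℂ) * Complex.I := by
    push_cast
    ring
  rw [e2pi, h, Complex.norm_exp_ofReal_mul_I]

lemma conj_e2pi (x : ℝ) : (starRingEnd ℂ) (e2pi x) = e2pi (-x) := by
  simp only [e2pi, ← Complex.exp_conj]
  congr 1
  simp [map_ofNat (starRingEnd ℂ) 2]

lemma e2pi_int (n : ℤ) : e2pi n = 1 := by
  rw [e2pi, Complex.exp_eq_one_iff]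
  exact ⟨n, by push_cast; ring⟩

lemma four_mul_abs_sub_round_le_norm (β : ℝ) : 4 * |β - round β| ≤ ‖e2pi β - 1‖ := by
  have h1 : e2pi β = e2pi (β - round β) := by
    conv_lhs => rw [← sub_add_cancel β (round β : ℝ), e2pi_add, e2pi_int, mul_one]
  have hx := abs_sub_round β
  rw [h1]
  generalize β - round β = x at hx
  have h2 : e2pi x = Complex.exp (Complex.I * ((2 * Real.pi * x : ℝ) : ℂ)) := by
    rw [e2pi]
    congr 1
    push_cast
    ring
  have h3 : 2 * Real.pi * x / 2 = Real.pi * x := by ring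
  rw [h2, Complex.norm_exp_I_mul_ofReal_sub_one, norm_mul, Real.norm_eq_abs, Real.norm_eq_abs,
    abs_two, h3]
  have h4 : |Real.pi * x| ≤ Real.pi / 2 := by
    rw [abs_mul, abs_of_pos Real.pi_pos]
    nlinarith [Real.pi_pos]
  have h5 := Real.mul_abs_le_abs_sin h4
  rw [abs_mul, abs_of_pos Real.pi_pos] at h5
  have h6 : 2 / Real.pi * (Real.pi * |x|) = 2 * |x| := by
    field_simp
  linarith

lemma norm_geom_sum_e2pi_mul_le (c β : ℝ) (A B : ℕ) :
    ‖∑ m ∈ Finset.Ico A B, e2pi (c + β * m)‖ * (2 * |β - round β|) ≤ 1 := by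
  rcases le_or_gt B A with h | h
  · simp [Finset.Ico_eq_empty_of_le h]
  have key : (e2pi β - 1) * ∑ m ∈ Finset.Ico A B, e2pi (c + β * m) =
      e2pi (c + β * B) - e2pi (c + β * A) := by
    rw [← Finset.sum_Ico_sub (fun m : ℕ => e2pi (c + β * m)) h.le, Finset.mul_sum]
    refine Finset.sum_congr rfl fun m _ => ?_
    have : c + β * ((m + 1 : ℕ) : ℝ) = β + (c + β * m) := by
      push_cast
      ring
    rw [this, e2pi_add β]
    ring
  have h1 : ‖(e2pi β - 1) * ∑ m ∈ Finset.Ico A B, e2pi (c + β * m)‖ ≤ 2 := by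
    rw [key]
    refine (norm_sub_le _ _).trans ?_
    rw [norm_e2pi, norm_e2pi]
    norm_num
  rw [norm_mul] at h1
  nlinarith [four_mul_abs_sub_round_le_norm β,
    norm_nonneg (∑ m ∈ Finset.Ico A B, e2pi (c + β * m))]

/-- A version of `min M ‖β‖⁻¹`, where `‖β‖` is the distance from `β` to the nearest integer. -/
noncomputable def distKernel (M : ℕ) (β : ℝ) : ℝ := M / (1 + M * |β - round β|)

lemma distKernel_nonneg (M : ℕ) (β : ℝ) : 0 ≤ distKernel M β := by
  unfold distKernel
  positivity

lemma distKernel_le (M : ℕ) (β : ℝ) : distKernel M β ≤ M := by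
  unfold distKernel
  refine div_le_self (by positivity) ?_
  have : (0 : ℝ) ≤ M * |β - round β| := by positivity
  linarith

lemma distKernel_mul_le (M : ℕ) (β : ℝ) : distKernel M β * |β - round β| ≤ 1 := by
  unfold distKernel
  rw [div_mul_eq_mul_div, div_le_one (by positivity)]
  linarith

lemma norm_geom_sum_e2pi_le (c β : ℝ) {A B M : ℕ} (h : B ≤ A + M) :
    ‖∑ m ∈ Finset.Ico A B, e2pi (c + β * m)‖ ≤ 2 * distKernel M β := by
  have h1 := norm_geom_sum_e2pi_mul_le c β A B
  have h2 : ‖∑ m ∈ Finset.Ico A B, e2pi (c + β * m)‖ ≤ M := by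
    refine (norm_sum_le _ _).trans ?_
    simp only [norm_e2pi, Finset.sum_const, Nat.card_Ico, nsmul_eq_mul, mul_one]
    exact_mod_cast (by omega : B - A ≤ M)
  unfold distKernel
  rw [← mul_div_assoc, le_div_iff₀ (by positivity)]
  have h3 : (0 : ℝ) ≤ M := by positivity
  nlinarith

/-- Expanding a square into its diagonal and off-diagonal parts. -/
lemma norm_sum_sq_eq {s : Finset ℕ} (f : ℕ → ℂ) :
    ‖∑ n ∈ s, f n‖ ^ 2 = ∑ n ∈ s, ‖f n‖ ^ 2 +
      2 * (∑ p ∈ (s ×ˢ s).filter (fun p => p.1 < p.2), (starRingEnd ℂ) (f p.1) * f p.2).re := by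
  set D := ∑ p ∈ (s ×ˢ s).filter (fun p => p.1 < p.2), (starRingEnd ℂ) (f p.1) * f p.2 with hD
  have h1 : ((‖∑ n ∈ s, f n‖ ^ 2 : ℝ) : ℂ) =
      ((∑ n ∈ s, ‖f n‖ ^ 2 : ℝ) : ℂ) + (D + (starRingEnd ℂ) D) := by
    have h2 : (starRingEnd ℂ) D =
        ∑ p ∈ (s ×ˢ s).filter (fun p => p.2 < p.1), (starRingEnd ℂ) (f p.1) * f p.2 := by
      rw [hD, map_sum]
      refine Finset.sum_bij' (fun p _ => p.swap) (fun p _ => p.swap) ?_ ?_ ?_ ?_ ?_ <;>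
        simp +contextual [mul_comm]
    have h3 : ((∑ n ∈ s, ‖f n‖ ^ 2 : ℝ) : ℂ) =
        ∑ p ∈ (s ×ˢ s).filter (fun p => p.1 = p.2), (starRingEnd ℂ) (f p.1) * f p.2 := by
      push_cast
      refine Finset.sum_bij' (fun n _ => (n, n)) (fun p _ => p.1) ?_ ?_ ?_ ?_ ?_ <;>
        simp +contextual [Complex.conj_mul']
    have h4 : ((‖∑ n ∈ s, f n‖ ^ 2 : ℝ) : ℂ) =
        ∑ p ∈ s ×ˢ s, (starRingEnd ℂ) (f p.1) * f p.2 := by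
      push_cast
      rw [← Complex.conj_mul', map_sum, Finset.sum_mul_sum, Finset.sum_product]
    rw [h4, h3, h2, hD, Finset.sum_filter, Finset.sum_filter, Finset.sum_filter,
      ← Finset.sum_add_distrib, ← Finset.sum_add_distrib]
    refine Finset.sum_congr rfl fun p _ => ?_
    rcases lt_trichotomy p.1 p.2 with h | h | h
    · simp [h, h.ne, h.le]
    · simp [h]
    · simp [h, h.ne', h.le]
  have h5 := congrArg Complex.re h1
  simp only [Complex.ofReal_re, Complex.add_re, Complex.conj_re] at h5
  linarith

/-- The Weyl differencing bound for quadratic exponential sums over subintervals. -/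
lemma norm_weyl_sum_sq_le (γ : ℝ) {A B M : ℕ} (h : B ≤ A + M) :
    ‖∑ n ∈ Finset.Ico A B, e2pi (γ * (n : ℝ) ^ 2)‖ ^ 2 ≤
      M + 4 * ∑ h ∈ Finset.Icc 1 M, distKernel M (γ * (2 * h : ℕ)) := by
  rw [norm_sum_sq_eq]
  have h1 : ∑ n ∈ Finset.Ico A B, ‖e2pi (γ * (n : ℝ) ^ 2)‖ ^ 2 ≤ (M : ℝ) := by
    simp only [norm_e2pi, one_pow, Finset.sum_const, Nat.card_Ico, nsmul_eq_mul, mul_one]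
    exact_mod_cast (by omega : B - A ≤ M)
  have h2 : ∑ p ∈ (Finset.Ico A B ×ˢ Finset.Ico A B).filter (fun p => p.1 < p.2),
      (starRingEnd ℂ) (e2pi (γ * (p.1 : ℝ) ^ 2)) * e2pi (γ * (p.2 : ℝ) ^ 2) =
      ∑ h ∈ Finset.Icc 1 M, ∑ m ∈ Finset.Ico A (B - h),
        e2pi (γ * (h : ℝ) ^ 2 + γ * (2 * h : ℕ) * m) := by
    rw [Finset.sum_sigma']
    refine Finset.sum_bij' (fun p _ => ⟨p.2 - p.1, p.1⟩) (fun x _ => (x.2, x.2 + x.1))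
      ?_ ?_ ?_ ?_ ?_
    · rintro ⟨x, y⟩ hp
      simp only [Finset.mem_filter, Finset.mem_product, Finset.mem_Ico, Finset.mem_sigma,
        Finset.mem_Icc] at hp ⊢
      omega
    · rintro ⟨x, y⟩ hp
      simp only [Finset.mem_filter, Finset.mem_product, Finset.mem_Ico, Finset.mem_sigma,
        Finset.mem_Icc] at hp ⊢
      omega
    · rintro ⟨x, y⟩ hp
      simp only [Finset.mem_filter, Finset.mem_product, Finset.mem_Ico] at hp
      simp only [Prod.mk.injEq, true_and]
      omega
    · rintro ⟨x, y⟩ hp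
      simp
    · rintro ⟨x, y⟩ hp
      simp only [Finset.mem_filter, Finset.mem_product, Finset.mem_Ico] at hp
      rw [conj_e2pi, ← e2pi_add]
      congr 1
      push_cast [Nat.cast_sub hp.2.le]
      ring
  have h3 : ‖∑ h ∈ Finset.Icc 1 M, ∑ m ∈ Finset.Ico A (B - h),
        e2pi (γ * (h : ℝ) ^ 2 + γ * (2 * h : ℕ) * m)‖ ≤
      ∑ h ∈ Finset.Icc 1 M, 2 * distKernel M (γ * (2 * h : ℕ)) :=
    norm_sum_le_of_le _ fun h _ => norm_geom_sum_e2pi_le _ _ (by omega)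
  rw [h2]
  rw [← Finset.mul_sum] at h3
  have h4 := Complex.re_le_norm (∑ h ∈ Finset.Icc 1 M, ∑ m ∈ Finset.Ico A (B - h),
    e2pi (γ * (h : ℝ) ^ 2 + γ * (2 * h : ℕ) * m))
  linarith

lemma sum_boundary_le (M : ℕ) {q : ℕ} (hq : 0 < q) :
    ∑ t ∈ Finset.range q, (if t ≤ 1 then (M : ℝ) else q / ((t - 1 : ℕ) : ℝ)) ≤
      2 * M + q * (1 + Real.log q) := by
  have h1 : ∑ t ∈ Finset.range q, (if t ≤ 1 then (M : ℝ) else q / ((t - 1 : ℕ) : ℝ)) ≤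
      ∑ t ∈ Finset.range (q + 2), (if t ≤ 1 then (M : ℝ) else q / ((t - 1 : ℕ) : ℝ)) := by
    refine Finset.sum_le_sum_of_subset_of_nonneg (Finset.range_mono (by omega)) ?_
    intro t _ _
    split_ifs <;> positivity
  have h2 : ∑ t ∈ Finset.range q, (q : ℝ) / ((t : ℝ) + 1) ≤ q * (1 + Real.log q) := by
    have h3 := harmonic_le_one_add_log q
    simp only [harmonic, Rat.cast_sum, Rat.cast_inv] at h3
    push_cast at h3
    simp only [div_eq_mul_inv, ← Finset.mul_sum]
    gcongr
  rw [Finset.sum_range_succ', Finset.sum_range_succ'] at h1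
  have h4 : ∀ t : ℕ, ¬ (t + 1 + 1 ≤ 1) := by omega
  simp only [h4, if_false, Nat.add_sub_cancel, zero_add, le_refl, if_true, zero_le] at h1
  push_cast at h1
  linarith

lemma distKernel_add_int_le {M q s : ℕ} (hs : s < q) (z : ℤ) {η β : ℝ}
    (h1 : -1 ≤ η) (h2 : η ≤ 2) (hβ : q * β = s + η + q * z) :
    distKernel M β ≤ (if s ≤ 1 then (M : ℝ) else q / ((s - 1 : ℕ) : ℝ)) +
      (if q - 1 - s ≤ 1 then (M : ℝ) else q / ((q - 1 - s - 1 : ℕ) : ℝ)) := by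
  have hM := distKernel_le M β
  have hn := distKernel_nonneg M β
  have hk := distKernel_mul_le M β
  have hp : ∀ t : ℕ, 0 ≤ (if t ≤ 1 then (M : ℝ) else q / ((t - 1 : ℕ) : ℝ)) := by
    intro t
    split_ifs <;> positivity
  have hp1 := hp s
  have hp2 := hp (q - 1 - s)
  by_cases c1 : s ≤ 1
  · rw [if_pos c1] at hp1 ⊢
    linarith
  by_cases c2 : q - 1 - s ≤ 1
  · rw [if_pos c2] at hp2 ⊢
    linarith
  have hq : (0 : ℝ) < q := by exact_mod_cast (by omega : 0 < q)
  have hd : ∀ t : ℕ, 1 < t → ((t : ℝ) - 1) ≤ q * |β - round β| →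
      distKernel M β ≤ q / ((t - 1 : ℕ) : ℝ) := by
    intro t ht h
    have ht' : ((t - 1 : ℕ) : ℝ) = t - 1 := by push_cast [Nat.cast_sub ht.le]; ring
    have ht1 : (0 : ℝ) < (t : ℝ) - 1 := by
      have : (1 : ℝ) < t := by exact_mod_cast ht
      linarith
    rw [ht', le_div_iff₀ ht1]
    nlinarith
  have habs : (q : ℝ) * |β - round β| = |s + η + q * z - q * round β| := by
    rw [← hβ, ← mul_sub, abs_mul, abs_of_pos hq]
  rcases le_or_gt (round β) z with c | c
  · have := hd s (by omega) (by
      rw [habs]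
      refine le_trans ?_ (le_abs_self _)
      have : (round β : ℝ) ≤ z := by exact_mod_cast c
      nlinarith)
    rw [if_neg c1] at hp1 ⊢
    linarith
  · have := hd (q - 1 - s) (by omega) (by
      rw [habs]
      refine le_trans ?_ (neg_le_abs _)
      have h5 : (z : ℝ) + 1 ≤ round β := by exact_mod_cast c
      have h6 : ((q - 1 - s : ℕ) : ℝ) = q - 1 - s := by
        rw [Nat.cast_sub (by omega), Nat.cast_sub (by omega)]
        simp
      rw [h6]
      nlinarith)
    rw [if_neg c2] at hp2 ⊢
    linarith

lemma sum_distKernel_block_le (M j₀ : ℕ) {α : ℝ} {a : ℤ} {q : ℕ} (hq : 0 < q)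
    (hα : |α - (a : ℝ) / (q : ℝ)| ≤ 1 / (q : ℝ) ^ 2) (hc : Int.gcd a (q : ℤ) = 1) :
    ∑ i ∈ Finset.range q, distKernel M (α * ((j₀ + i : ℕ) : ℝ)) ≤
      4 * M + 2 * q * (1 + Real.log q) := by
  have hqR : (0 : ℝ) < q := by exact_mod_cast hq
  have hqZ : (0 : ℤ) < q := by exact_mod_cast hq
  set b : ℤ := ⌊q * α * j₀⌋ with hb
  set s : ℕ → ℕ := fun i => ((b + a * i) % q).toNat with hs
  have hsc : ∀ i, ((s i : ℕ) : ℤ) = (b + a * i) % q := fun i =>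
    Int.toNat_of_nonneg (Int.emod_nonneg _ hqZ.ne')
  have hslt : ∀ i, s i < q := by
    intro i
    have := Int.emod_lt_of_pos (b + a * i) hqZ
    rw [← hsc] at this
    exact_mod_cast this
  set F : ℕ → ℝ := fun t => if t ≤ 1 then (M : ℝ) else q / ((t - 1 : ℕ) : ℝ) with hF
  have hle : ∀ i ∈ Finset.range q,
      distKernel M (α * ((j₀ + i : ℕ) : ℝ)) ≤ F (s i) + F (q - 1 - s i) := by
    intro i hi
    have hi' : (i : ℝ) < q := by exact_mod_cast Finset.mem_range.mp hi
    have hi0 : (0 : ℝ) ≤ i := by positivity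
    set δ := α - (a : ℝ) / (q : ℝ) with hδ
    have hαe : q * α = a + q * δ := by
      rw [hδ]
      field_simp
      ring
    have hqδ : |q * δ * i| ≤ 1 := by
      rw [abs_mul, abs_mul, abs_of_pos hqR, abs_of_nonneg hi0]
      calc q * |δ| * i ≤ q * (1 / (q : ℝ) ^ 2) * q := by gcongr
        _ = 1 := by field_simp
    have hf1 := Int.floor_le (q * α * j₀)
    have hf2 := Int.lt_floor_add_one (q * α * j₀)
    rw [← hb] at hf1 hf2
    obtain ⟨hA, hB⟩ := abs_le.mp hqδ
    refine distKernel_add_int_le (hslt i) ((b + a * i) / q)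
      (η := q * α * j₀ - b + q * δ * i) (by linarith) (by linarith) ?_
    have hdm := Int.emod_add_mul_ediv (b + a * i) q
    rw [← hsc] at hdm
    have hdm' : ((s i : ℕ) : ℝ) + q * (((b + a * i) / q : ℤ) : ℝ) = b + a * i := by
      exact_mod_cast hdm
    push_cast
    linear_combination (i : ℝ) * hαe - hdm'
  have hinj : Set.InjOn s (Finset.range q) := by
    intro i hi j hj hij
    have h1 : (b + a * i) % q = (b + a * j) % q := by rw [← hsc, ← hsc, hij]
    have h2 : (q : ℤ) ∣ a * (j - i) := by
      have := Int.ModEq.dvd (show b + a * i ≡ b + a * j [ZMOD q] from h1)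
      rwa [add_sub_add_left_eq_sub, ← mul_sub] at this
    have h3 : (q : ℤ) ∣ j - i :=
      Int.dvd_of_dvd_mul_right_of_gcd_one h2 (by rwa [Int.gcd_comm])
    have hi' := Finset.mem_range.mp (Finset.mem_coe.mp hi)
    have hj' := Finset.mem_range.mp (Finset.mem_coe.mp hj)
    have := Int.eq_zero_of_abs_lt_dvd h3 (by rw [abs_lt]; omega)
    omega
  have himg : (Finset.range q).image s = Finset.range q := by
    refine Finset.eq_of_subset_of_card_le ?_ ?_
    · intro x hx
      obtain ⟨i, _, rfl⟩ := Finset.mem_image.mp hx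
      exact Finset.mem_range.mpr (hslt i)
    · rw [Finset.card_image_of_injOn hinj]
  calc ∑ i ∈ Finset.range q, distKernel M (α * ((j₀ + i : ℕ) : ℝ))
      ≤ ∑ i ∈ Finset.range q, (F (s i) + F (q - 1 - s i)) := Finset.sum_le_sum hle
    _ = ∑ t ∈ (Finset.range q).image s, (F t + F (q - 1 - t)) :=
        (Finset.sum_image (f := fun t => F t + F (q - 1 - t)) hinj).symm
    _ = ∑ t ∈ Finset.range q, F t + ∑ t ∈ Finset.range q, F t := by
        rw [himg, Finset.sum_add_distrib, Finset.sum_range_reflect F q]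
    _ ≤ 4 * M + 2 * q * (1 + Real.log q) := by
        have := sum_boundary_le M hq
        linarith

lemma sum_distKernel_le (M J : ℕ) {α : ℝ} {a : ℤ} {q : ℕ} (hq : 0 < q)
    (hα : |α - (a : ℝ) / (q : ℝ)| ≤ 1 / (q : ℝ) ^ 2) (hc : Int.gcd a (q : ℤ) = 1) :
    ∑ j ∈ Finset.Icc 1 J, distKernel M (α * (j : ℝ)) ≤
      ((J : ℝ) / q + 1) * (4 * M + 2 * q * (1 + Real.log q)) := by
  have hqR : (0 : ℝ) < q := by exact_mod_cast hq
  have hlog : 0 ≤ Real.log q := Real.log_natCast_nonneg q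
  have hblocks : ∀ n : ℕ, ∑ j ∈ Finset.range (n * q), distKernel M (α * ((1 + j : ℕ) : ℝ)) ≤
      n * (4 * M + 2 * q * (1 + Real.log q)) := by
    intro n
    induction n with
    | zero => simp
    | succ n ih =>
      have := sum_distKernel_block_le M (1 + n * q) hq hα hc
      rw [Nat.succ_mul, Finset.sum_range_add]
      simp only [← add_assoc] at this ⊢
      push_cast at this ih ⊢
      linarith
  have h1 : ∑ j ∈ Finset.Icc 1 J, distKernel M (α * (j : ℝ)) =
      ∑ j ∈ Finset.range J, distKernel M (α * ((1 + j : ℕ) : ℝ)) := by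
    rw [← Finset.Ico_add_one_right_eq_Icc, Finset.sum_Ico_eq_sum_range, Nat.add_sub_cancel]
  have h2 : J ≤ (J / q + 1) * q := by
    have := Nat.lt_div_mul_add (a := J) hq
    rw [Nat.succ_mul]
    omega
  rw [h1]
  refine (Finset.sum_le_sum_of_subset_of_nonneg (Finset.range_mono h2)
    fun _ _ _ => distKernel_nonneg _ _).trans ((hblocks _).trans ?_)
  gcongr
  push_cast
  gcongr
  exact Nat.cast_div_le

lemma exists_card_divisors_le_rpow {ε : ℝ} (hε : 0 < ε) :
    ∃ C : ℝ, 1 ≤ C ∧ ∀ n : ℕ, n ≠ 0 → (n.divisors.card : ℝ) ≤ C * (n : ℝ) ^ ε := by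
  set P : ℕ := ⌈(2 : ℝ) ^ (1 / ε)⌉₊ with hP
  set c : ℝ := max 1 (1 / (ε * Real.log 2)) with hc
  have hc1 : 1 ≤ c := le_max_left _ _
  have hl2 : 0 < Real.log 2 := Real.log_pos one_lt_two
  refine ⟨c ^ P, one_le_pow₀ hc1, fun n hn => ?_⟩
  have hloc : ∀ p ∈ n.primeFactors, ((n.factorization p + 1 : ℕ) : ℝ) ≤
      (if p < P then c else 1) * ((p : ℝ) ^ n.factorization p) ^ ε := by
    intro p hp
    have hp2 : (2 : ℝ) ≤ p := by exact_mod_cast (Nat.prime_of_mem_primeFactors hp).two_le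
    set k := n.factorization p
    rw [← Real.rpow_natCast, ← Real.rpow_mul (by positivity), mul_comm (k : ℝ),
      Real.rpow_mul (by positivity), Real.rpow_natCast]
    split_ifs with h
    · have h1 : 1 + ε * Real.log 2 ≤ (p : ℝ) ^ ε := by
        calc 1 + ε * Real.log 2 ≤ Real.exp (ε * Real.log 2) := by
              linarith [Real.add_one_le_exp (ε * Real.log 2)]
          _ = (2 : ℝ) ^ ε := by rw [Real.rpow_def_of_pos two_pos, mul_comm]
          _ ≤ (p : ℝ) ^ ε := by gcongr
      have h2 : 1 + k * (ε * Real.log 2) ≤ ((p : ℝ) ^ ε) ^ k :=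
        (one_add_mul_le_pow (by nlinarith) k).trans (by gcongr)
      have h3 : 1 ≤ c * (ε * Real.log 2) := by
        have := mul_le_mul_of_nonneg_right (le_max_right 1 (1 / (ε * Real.log 2)))
          (by positivity : 0 ≤ ε * Real.log 2)
        rwa [one_div, inv_mul_cancel₀ (by positivity), ← one_div] at this
      have hk : (0 : ℝ) ≤ k := by positivity
      push_cast
      calc (k : ℝ) + 1 ≤ c * (1 + k * (ε * Real.log 2)) := by nlinarith
        _ ≤ _ := by gcongr
    · have h1 : (2 : ℝ) ≤ (p : ℝ) ^ ε := by
        have h2 : (2 : ℝ) ^ (1 / ε) ≤ p :=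
          (Nat.le_ceil _).trans (by exact_mod_cast not_lt.mp h)
        calc (2 : ℝ) = ((2 : ℝ) ^ (1 / ε)) ^ ε := by
              rw [← Real.rpow_mul two_pos.le, one_div_mul_cancel hε.ne', Real.rpow_one]
          _ ≤ _ := by gcongr
      have h2 : ((k + 1 : ℕ) : ℝ) ≤ 2 ^ k := by exact_mod_cast Nat.lt_two_pow_self
      rw [one_mul]
      exact h2.trans (by gcongr)
  have hprod : (n : ℝ) ^ ε = ∏ p ∈ n.primeFactors, ((p : ℝ) ^ n.factorization p) ^ ε := by
    rw [Real.finsetProd_rpow _ _ fun _ _ => by positivity]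
    congr 1
    conv_lhs => rw [← Nat.prod_factorization_pow_eq_self hn]
    rw [Finsupp.prod, Nat.support_factorization]
    push_cast
    rfl
  rw [Nat.card_divisors hn, hprod]
  rw [Nat.cast_prod]
  refine (Finset.prod_le_prod (fun _ _ => by positivity) hloc).trans ?_
  rw [Finset.prod_mul_distrib]
  refine mul_le_mul_of_nonneg_right ?_ (Finset.prod_nonneg fun _ _ => by positivity)
  rw [Finset.prod_ite, Finset.prod_const, Finset.prod_const_one, mul_one]
  refine pow_le_pow_right₀ hc1 ?_
  calc _ ≤ (Finset.range P).card := Finset.card_le_card fun p hp => by simp_all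
    _ = P := Finset.card_range P

/-- If `i` is determined by the value `J i` together with two divisors of it, then each value is
attained few times. -/
lemma sum_comp_le_of_divisors {ι : Type*} {s : Finset ι} {J g₁ g₂ : ι → ℕ} {J₀ : ℕ} {T : ℝ}
    (hJ : ∀ i ∈ s, J i ∈ Finset.Icc 1 J₀) (h₁ : ∀ i ∈ s, g₁ i ∣ J i) (h₂ : ∀ i ∈ s, g₂ i ∣ J i)
    (hinj : Set.InjOn (fun i => (J i, g₁ i, g₂ i)) s)
    (hT : ∀ j ∈ Finset.Icc 1 J₀, (j.divisors.card : ℝ) ≤ T) {F : ℕ → ℝ} (hF : ∀ j, 0 ≤ F j) :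
    ∑ i ∈ s, F (J i) ≤ T ^ 2 * ∑ j ∈ Finset.Icc 1 J₀, F j := by
  rw [← Finset.sum_fiberwise_of_maps_to hJ, Finset.mul_sum]
  refine Finset.sum_le_sum fun j hj => ?_
  have h1 : ∑ i ∈ s with J i = j, F (J i) = (s.filter (fun i => J i = j)).card * F j := by
    rw [← nsmul_eq_mul, ← Finset.sum_const]
    refine Finset.sum_congr rfl fun i hi => ?_
    rw [(Finset.mem_filter.mp hi).2]
  have h2 : (s.filter (fun i => J i = j)).card ≤ (j.divisors ×ˢ j.divisors).card := by
    have hj0 : j ≠ 0 := by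
      have := (Finset.mem_Icc.mp hj).1
      omega
    refine Finset.card_le_card_of_injOn (fun i => (g₁ i, g₂ i)) ?_ ?_
    · intro i hi
      obtain ⟨his, rfl⟩ := Finset.mem_filter.mp (Finset.mem_coe.mp hi)
      simp [h₁ i his, h₂ i his, hj0]
    · intro i hi i' hi' h
      obtain ⟨his, hij⟩ := Finset.mem_filter.mp (Finset.mem_coe.mp hi)
      obtain ⟨his', hij'⟩ := Finset.mem_filter.mp (Finset.mem_coe.mp hi')
      refine hinj his his' ?_
      simp only [Prod.mk.injEq] at h ⊢
      exact ⟨hij.trans hij'.symm, h⟩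
  rw [h1]
  refine mul_le_mul_of_nonneg_right ?_ (hF j)
  rw [Finset.card_product] at h2
  have h3 : ((s.filter (fun i => J i = j)).card : ℝ) ≤ j.divisors.card * j.divisors.card := by
    exact_mod_cast h2
  have := hT j hj
  nlinarith [Nat.cast_nonneg (α := ℝ) j.divisors.card]

lemma typeII_offdiag_le {M K : ℕ} (α : ℝ) (l u : ℕ → ℕ) {T : ℝ}
    (hT : ∀ j ∈ Finset.Icc 1 (2 * M * K ^ 2), (j.divisors.card : ℝ) ≤ T) :
    (∑ p ∈ (Finset.Icc 1 K ×ˢ Finset.Icc 1 K).filter (fun p => p.1 < p.2),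
      ‖∑ m ∈ Finset.Ico (max M (max (l p.1) (l p.2))) (min (2 * M) (min (u p.1) (u p.2))),
        e2pi (α * ((p.2 : ℝ) ^ 2 - (p.1 : ℝ) ^ 2) * (m : ℝ) ^ 2)‖) ^ 2 ≤
      K ^ 2 * (K ^ 2 * M +
        4 * (T ^ 2 * ∑ j ∈ Finset.Icc (1 : ℕ) (2 * M * K ^ 2), distKernel M (α * (j : ℝ)))) := by
  set s := (Finset.Icc 1 K ×ˢ Finset.Icc 1 K).filter (fun p : ℕ × ℕ => p.1 < p.2) with hs
  have hmem : ∀ p ∈ s, 1 ≤ p.1 ∧ p.1 < p.2 ∧ p.2 ≤ K := by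
    intro p hp
    simp only [hs, Finset.mem_filter, Finset.mem_product, Finset.mem_Icc] at hp
    omega
  have hcard : (s.card : ℝ) ≤ K ^ 2 := by
    have : s.card ≤ K ^ 2 := by
      refine (Finset.card_filter_le _ _).trans ?_
      simp [sq]
    exact_mod_cast this
  have hreal : ∀ p ∈ s, ((p.2 : ℝ) ^ 2 - (p.1 : ℝ) ^ 2) =
      (((p.2 - p.1) * (p.2 + p.1) : ℕ) : ℝ) := by
    intro p hp
    push_cast [Nat.cast_sub (hmem p hp).2.1.le]
    ring
  have hweyl : ∑ p ∈ s,
      ‖∑ m ∈ Finset.Ico (max M (max (l p.1) (l p.2))) (min (2 * M) (min (u p.1) (u p.2))),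
        e2pi (α * ((p.2 : ℝ) ^ 2 - (p.1 : ℝ) ^ 2) * (m : ℝ) ^ 2)‖ ^ 2 ≤
      s.card * M + 4 * ∑ x ∈ s ×ˢ Finset.Icc 1 M,
        distKernel M (α * ((2 * x.2 * ((x.1.2 - x.1.1) * (x.1.2 + x.1.1)) : ℕ) : ℝ)) := by
    rw [Finset.sum_product, ← nsmul_eq_mul, ← Finset.sum_const, Finset.mul_sum,
      ← Finset.sum_add_distrib]
    refine Finset.sum_le_sum fun p hp => (norm_weyl_sum_sq_le _ (M := M) (by omega)).trans ?_
    refine le_of_eq ?_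
    congr 2
    refine Finset.sum_congr rfl fun h _ => ?_
    congr 1
    rw [hreal p hp]
    push_cast
    ring
  have hdiv : ∑ x ∈ s ×ˢ Finset.Icc 1 M,
        distKernel M (α * ((2 * x.2 * ((x.1.2 - x.1.1) * (x.1.2 + x.1.1)) : ℕ) : ℝ)) ≤
      T ^ 2 * ∑ j ∈ Finset.Icc (1 : ℕ) (2 * M * K ^ 2), distKernel M (α * (j : ℝ)) := by
    refine sum_comp_le_of_divisors (F := fun j : ℕ => distKernel M (α * (j : ℝ)))
      (J := fun x : (ℕ × ℕ) × ℕ => 2 * x.2 * ((x.1.2 - x.1.1) * (x.1.2 + x.1.1)))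
      (g₁ := fun x => x.1.2 - x.1.1) (g₂ := fun x => x.1.2 + x.1.1) ?_ ?_ ?_ ?_ hT ?_
    · rintro ⟨p, h⟩ hx
      obtain ⟨hp, hh⟩ := Finset.mem_product.mp hx
      obtain ⟨h1, h2, h3⟩ := hmem p hp
      obtain ⟨hh1, hh2⟩ := Finset.mem_Icc.mp hh
      simp only at hh1 hh2 ⊢
      refine Finset.mem_Icc.mpr ⟨?_, ?_⟩
      · have : 0 < p.2 - p.1 := by omega
        have : 0 < p.2 + p.1 := by omega
        exact Nat.one_le_iff_ne_zero.mpr (by positivity)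
      · have h4 : (p.2 - p.1) * (p.2 + p.1) ≤ K ^ 2 := by
          have h5 : (p.2 - p.1) * (p.2 + p.1) = p.2 ^ 2 - p.1 ^ 2 := by
            rw [Nat.sq_sub_sq, mul_comm]
          rw [h5]
          exact (Nat.sub_le _ _).trans (Nat.pow_le_pow_left h3 2)
        gcongr
    · rintro ⟨p, h⟩ _
      exact Dvd.dvd.mul_left (Dvd.intro _ rfl) _
    · rintro ⟨p, h⟩ _
      exact Dvd.dvd.mul_left (Dvd.intro_left _ rfl) _
    · rintro ⟨⟨a, b⟩, h⟩ hx ⟨⟨a', b'⟩, h'⟩ hx' hxx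
      have hx1 := hmem _ (Finset.mem_product.mp (Finset.mem_coe.mp hx)).1
      have hx1' := hmem _ (Finset.mem_product.mp (Finset.mem_coe.mp hx')).1
      simp only [Prod.mk.injEq] at hxx hx1 hx1' ⊢
      obtain ⟨e1, e2, e3⟩ := hxx
      have ea : a = a' := by omega
      have eb : b = b' := by omega
      subst ea eb
      refine ⟨⟨rfl, rfl⟩, ?_⟩
      have : 0 < (b - a) * (b + a) := Nat.mul_pos (by omega) (by omega)
      have := Nat.eq_of_mul_eq_mul_right this e1
      omega
    · exact fun j => distKernel_nonneg _ _
  refine sq_sum_le_card_mul_sum_sq.trans ?_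
  have hM : (0 : ℝ) ≤ M := by positivity
  gcongr
  refine hweyl.trans ?_
  gcongr

/-- The bilinear estimate on a dyadic block. -/
lemma typeII_block_le {M K : ℕ} (α : ℝ) {A B : ℝ} {x y : ℕ → ℂ} (hx : ∀ m, ‖x m‖ ≤ A)
    (hy : ∀ k, ‖y k‖ ≤ B) (l u : ℕ → ℕ) {T : ℝ}
    (hT : ∀ j ∈ Finset.Icc 1 (2 * M * K ^ 2), (j.divisors.card : ℝ) ≤ T) :
    ‖∑ m ∈ Finset.Ico M (2 * M), ∑ k ∈ Finset.Icc 1 K,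
      if l k ≤ m ∧ m < u k then x m * y k * e2pi (α * ((m * k : ℕ) : ℝ) ^ 2) else 0‖ ^ 4 ≤
      A ^ 4 * B ^ 4 * (2 * M ^ 4 * K ^ 2 + 8 * (M ^ 2 * (K ^ 2 * (K ^ 2 * M +
        4 * (T ^ 2 * ∑ j ∈ Finset.Icc (1 : ℕ) (2 * M * K ^ 2), distKernel M (α * (j : ℝ))))))) := by
  have hA : 0 ≤ A := (norm_nonneg _).trans (hx 0)
  have hB : 0 ≤ B := (norm_nonneg _).trans (hy 0)
  set c : ℕ → ℕ → ℂ := fun m k =>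
    if l k ≤ m ∧ m < u k then y k * e2pi (α * ((m * k : ℕ) : ℝ) ^ 2) else 0 with hc
  have hcn : ∀ m k, ‖c m k‖ ≤ B := by
    intro m k
    simp only [hc]
    split_ifs
    · rw [norm_mul, norm_e2pi, mul_one]
      exact hy k
    · simpa using hB
  have hS : ∑ m ∈ Finset.Ico M (2 * M), ∑ k ∈ Finset.Icc 1 K,
      (if l k ≤ m ∧ m < u k then x m * y k * e2pi (α * ((m * k : ℕ) : ℝ) ^ 2) else 0) =
      ∑ m ∈ Finset.Ico M (2 * M), x m * ∑ k ∈ Finset.Icc 1 K, c m k := by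
    refine Finset.sum_congr rfl fun m _ => ?_
    rw [Finset.mul_sum]
    refine Finset.sum_congr rfl fun k _ => ?_
    simp only [hc, mul_ite, mul_zero, mul_assoc]
  rw [hS]
  have hcs : ‖∑ m ∈ Finset.Ico M (2 * M), x m * ∑ k ∈ Finset.Icc 1 K, c m k‖ ^ 2 ≤
      (M * A ^ 2) * ∑ m ∈ Finset.Ico M (2 * M), ‖∑ k ∈ Finset.Icc 1 K, c m k‖ ^ 2 := by
    have h1 : ‖∑ m ∈ Finset.Ico M (2 * M), x m * ∑ k ∈ Finset.Icc 1 K, c m k‖ ≤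
        ∑ m ∈ Finset.Ico M (2 * M), ‖x m‖ * ‖∑ k ∈ Finset.Icc 1 K, c m k‖ :=
      norm_sum_le_of_le _ fun m _ => (norm_mul _ _).le
    refine (pow_le_pow_left₀ (norm_nonneg _) h1 2).trans
      ((Finset.sum_mul_sq_le_sq_mul_sq _ _ _).trans ?_)
    refine mul_le_mul_of_nonneg_right ?_ (Finset.sum_nonneg fun _ _ => by positivity)
    calc ∑ m ∈ Finset.Ico M (2 * M), ‖x m‖ ^ 2 ≤ ∑ m ∈ Finset.Ico M (2 * M), A ^ 2 := by
          gcongr with m _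
          exact hx m
      _ = M * A ^ 2 := by
          rw [Finset.sum_const, Nat.card_Ico, nsmul_eq_mul, two_mul, Nat.add_sub_cancel]
  set s := (Finset.Icc 1 K ×ˢ Finset.Icc 1 K).filter (fun p : ℕ × ℕ => p.1 < p.2) with hs
  set E := ∑ p ∈ s,
      ‖∑ m ∈ Finset.Ico (max M (max (l p.1) (l p.2))) (min (2 * M) (min (u p.1) (u p.2))),
        e2pi (α * ((p.2 : ℝ) ^ 2 - (p.1 : ℝ) ^ 2) * (m : ℝ) ^ 2)‖ with hE
  have hE2 := typeII_offdiag_le (M := M) (K := K) α l u hT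
  rw [← hs, ← hE] at hE2
  have hE0 : 0 ≤ E := Finset.sum_nonneg fun _ _ => norm_nonneg _
  have hsq : ∑ m ∈ Finset.Ico M (2 * M), ‖∑ k ∈ Finset.Icc 1 K, c m k‖ ^ 2 ≤
      B ^ 2 * (M * K + 2 * E) := by
    simp only [norm_sum_sq_eq]
    rw [Finset.sum_add_distrib, ← Finset.mul_sum, ← Complex.re_sum]
    have h1 : ∑ m ∈ Finset.Ico M (2 * M), ∑ k ∈ Finset.Icc 1 K, ‖c m k‖ ^ 2 ≤
        B ^ 2 * (M * K) := by
      calc _ ≤ ∑ m ∈ Finset.Ico M (2 * M), ∑ k ∈ Finset.Icc 1 K, B ^ 2 := by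
            gcongr with m _ k _
            exact hcn m k
        _ = B ^ 2 * (M * K) := by
            simp only [Finset.sum_const, Nat.card_Ico, Nat.card_Icc, nsmul_eq_mul,
              two_mul, Nat.add_sub_cancel]
            ring
    have h2 : ‖∑ m ∈ Finset.Ico M (2 * M), ∑ p ∈ s, (starRingEnd ℂ) (c m p.1) * c m p.2‖ ≤
        B ^ 2 * E := by
      rw [Finset.sum_comm, hE, Finset.mul_sum]
      refine norm_sum_le_of_le _ fun p hp => ?_
      have h3 : ∑ m ∈ Finset.Ico M (2 * M), (starRingEnd ℂ) (c m p.1) * c m p.2 =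
          (starRingEnd ℂ) (y p.1) * y p.2 *
          ∑ m ∈ Finset.Ico (max M (max (l p.1) (l p.2))) (min (2 * M) (min (u p.1) (u p.2))),
            e2pi (α * ((p.2 : ℝ) ^ 2 - (p.1 : ℝ) ^ 2) * (m : ℝ) ^ 2) := by
        have h4 : Finset.Ico (max M (max (l p.1) (l p.2))) (min (2 * M) (min (u p.1) (u p.2))) =
            (Finset.Ico M (2 * M)).filter
              (fun m => (l p.1 ≤ m ∧ m < u p.1) ∧ (l p.2 ≤ m ∧ m < u p.2)) := by
          ext m
          simp only [Finset.mem_Ico, Finset.mem_filter, max_le_iff, lt_min_iff]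
          tauto
        rw [h4, Finset.sum_filter, Finset.mul_sum]
        refine Finset.sum_congr rfl fun m _ => ?_
        have h5 : α * ((p.2 : ℝ) ^ 2 - (p.1 : ℝ) ^ 2) * (m : ℝ) ^ 2 =
            -(α * ((m * p.1 : ℕ) : ℝ) ^ 2) + α * ((m * p.2 : ℕ) : ℝ) ^ 2 := by
          push_cast
          ring
        rw [h5, e2pi_add, ← conj_e2pi]
        simp only [hc]
        by_cases c1 : l p.1 ≤ m ∧ m < u p.1
        · by_cases c2 : l p.2 ≤ m ∧ m < u p.2
          · rw [if_pos c1, if_pos c2, if_pos ⟨c1, c2⟩, map_mul]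
            ring
          · have c3 : ¬((l p.1 ≤ m ∧ m < u p.1) ∧ (l p.2 ≤ m ∧ m < u p.2)) := fun h => c2 h.2
            rw [if_neg c2, if_neg c3, mul_zero, mul_zero]
        · have c3 : ¬((l p.1 ≤ m ∧ m < u p.1) ∧ (l p.2 ≤ m ∧ m < u p.2)) := fun h => c1 h.1
          rw [if_neg c1, if_neg c3, map_zero, zero_mul, mul_zero]
      rw [h3, norm_mul, norm_mul, RCLike.norm_conj, pow_two B]
      exact mul_le_mul_of_nonneg_right
        (mul_le_mul (hy _) (hy _) (norm_nonneg _) hB) (norm_nonneg _)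
    have := Complex.re_le_norm
      (∑ m ∈ Finset.Ico M (2 * M), ∑ p ∈ s, (starRingEnd ℂ) (c m p.1) * c m p.2)
    linarith
  have hM : (0 : ℝ) ≤ M := by positivity
  have hfin : ‖∑ m ∈ Finset.Ico M (2 * M), x m * ∑ k ∈ Finset.Icc 1 K, c m k‖ ^ 2 ≤
      (M * A ^ 2) * (B ^ 2 * (M * K + 2 * E)) := hcs.trans (by gcongr)
  have hfour := pow_le_pow_left₀ (by positivity) hfin 2
  rw [← pow_mul] at hfour
  refine hfour.trans ?_
  have h6 : ((M : ℝ) * K + 2 * E) ^ 2 ≤ 2 * (M * K) ^ 2 + 8 * E ^ 2 := by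
    nlinarith [sq_nonneg ((M : ℝ) * K - 2 * E)]
  calc ((M * A ^ 2) * (B ^ 2 * (M * K + 2 * E))) ^ 2
      = A ^ 4 * B ^ 4 * (M ^ 2 * (M * K + 2 * E) ^ 2) := by ring
    _ ≤ A ^ 4 * B ^ 4 * (M ^ 2 * (2 * (M * K) ^ 2 + 8 * E ^ 2)) := by gcongr
    _ = A ^ 4 * B ^ 4 * (2 * M ^ 4 * K ^ 2 + 8 * (M ^ 2 * E ^ 2)) := by ring
    _ ≤ _ := by gcongr

/-- The estimate for linear sums on a dyadic block. -/
lemma typeI_block_le {D H : ℕ} (hD : 0 < D) (α : ℝ) {r : ℕ → ℝ}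
    (hr : ∀ d ∈ Finset.Ico D (2 * D), r d ^ 2 ≤
      H + 4 * ∑ h ∈ Finset.Icc 1 H, distKernel H (α * (d : ℝ) ^ 2 * (2 * h : ℕ))) {T : ℝ}
    (hT : ∀ j ∈ Finset.Icc 1 (8 * D ^ 2 * H), (j.divisors.card : ℝ) ≤ T) :
    (∑ d ∈ Finset.Ico D (2 * D), r d) ^ 2 ≤ D * (D * H +
      4 * (T ^ 2 * ∑ j ∈ Finset.Icc (1 : ℕ) (8 * D ^ 2 * H), distKernel H (α * (j : ℝ)))) := by
  have hdiv : ∑ x ∈ Finset.Ico D (2 * D) ×ˢ Finset.Icc 1 H,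
      distKernel H (α * ((2 * x.2 * x.1 ^ 2 : ℕ) : ℝ)) ≤
      T ^ 2 * ∑ j ∈ Finset.Icc (1 : ℕ) (8 * D ^ 2 * H), distKernel H (α * (j : ℝ)) := by
    refine sum_comp_le_of_divisors (F := fun j : ℕ => distKernel H (α * (j : ℝ)))
      (J := fun x : ℕ × ℕ => 2 * x.2 * x.1 ^ 2) (g₁ := fun x => x.1) (g₂ := fun x => x.1)
      ?_ ?_ ?_ ?_ hT fun j => distKernel_nonneg _ _
    · rintro ⟨d, h⟩ hx
      simp only [Finset.mem_product, Finset.mem_Ico, Finset.mem_Icc] at hx ⊢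
      obtain ⟨⟨h1, h2⟩, h3, h4⟩ := hx
      constructor
      · have : 0 < d := by omega
        exact Nat.one_le_iff_ne_zero.mpr (by positivity)
      · calc 2 * h * d ^ 2 ≤ 2 * H * (2 * D) ^ 2 := by gcongr
          _ = 8 * D ^ 2 * H := by ring
    · rintro ⟨d, h⟩ _
      exact Dvd.dvd.mul_left (dvd_pow_self d two_ne_zero) _
    · rintro ⟨d, h⟩ _
      exact Dvd.dvd.mul_left (dvd_pow_self d two_ne_zero) _
    · rintro ⟨d, h⟩ hx ⟨d', h'⟩ hx' hxx
      have hd := Finset.mem_Ico.mp (Finset.mem_product.mp (Finset.mem_coe.mp hx)).1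
      simp only [Prod.mk.injEq] at hxx hd ⊢
      obtain ⟨e1, rfl, -⟩ := hxx
      refine ⟨rfl, ?_⟩
      have : 0 < d ^ 2 := pow_pos (by omega) 2
      have := Nat.eq_of_mul_eq_mul_right this e1
      omega
  have hcard : (Finset.Ico D (2 * D)).card = D := by
    rw [Nat.card_Ico]
    omega
  have h1 := sq_sum_le_card_mul_sum_sq (s := Finset.Ico D (2 * D)) (f := r)
  rw [hcard] at h1
  refine h1.trans ?_
  have h2 : ∑ d ∈ Finset.Ico D (2 * D), r d ^ 2 ≤
      D * H + 4 * ∑ x ∈ Finset.Ico D (2 * D) ×ˢ Finset.Icc 1 H,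
        distKernel H (α * ((2 * x.2 * x.1 ^ 2 : ℕ) : ℝ)) := by
    have h3 : (D : ℝ) * H = ∑ d ∈ Finset.Ico D (2 * D), (H : ℝ) := by
      rw [Finset.sum_const, hcard, nsmul_eq_mul]
    rw [Finset.sum_product, h3, Finset.mul_sum, ← Finset.sum_add_distrib]
    refine Finset.sum_le_sum fun d hd => (hr d hd).trans (le_of_eq ?_)
    congr 2
    refine Finset.sum_congr rfl fun h _ => ?_
    congr 1
    push_cast
    ring
  gcongr
  exact h2.trans (by gcongr)

/-- The relations between the parameters in the main estimate: `Δ` dominates the saving, `V` is the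
Vaughan cut-off, `Y` absorbs divisor functions and logarithms, and `R = N Δ ^ (1 / 4)`. -/
structure VaughanParams (N V q : ℕ) (a : ℤ) (α Δ Y R : ℝ) : Prop where
  N_pos : 0 < N
  q_pos : 0 < q
  approx : |α - (a : ℝ) / (q : ℝ)| ≤ 1 / (q : ℝ) ^ 2
  gcd_eq : Int.gcd a (q : ℤ) = 1
  Δ_pos : 0 < Δ
  inv_q_le : 1 ≤ Δ * q
  q_le : q ≤ N ^ 2 * Δ
  one_le : 1 ≤ N * Δ ^ 2
  V_pos : 0 < V
  V_le : Δ * V ^ 2 ≤ 1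
  le_V : 1 ≤ 4 * Δ * V ^ 2
  one_le_Y : 1 ≤ Y
  divisors_le : ∀ j ∈ Finset.Icc 1 (8 * N ^ 2), (j.divisors.card : ℝ) ≤ Y
  log_q_le : 1 + Real.log q ≤ Y
  log_N_le : Real.log N ≤ Y
  natLog_le : ((Nat.log 2 N + 1 : ℕ) : ℝ) ≤ Y
  R_nonneg : 0 ≤ R
  R_pow : R ^ 4 = N ^ 4 * Δ

namespace VaughanParams

variable {N V q : ℕ} {a : ℤ} {α Δ Y R : ℝ}

lemma one_le_N_real (P : VaughanParams N V q a α Δ Y R) : (1 : ℝ) ≤ N := by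
  exact_mod_cast P.N_pos

lemma Δ_le_one (P : VaughanParams N V q a α Δ Y R) : Δ ≤ 1 := by
  have h1 : (1 : ℝ) ≤ V := by exact_mod_cast P.V_pos
  have h2 : (1 : ℝ) ≤ (V : ℝ) ^ 2 := one_le_pow₀ h1
  nlinarith [P.V_le, P.Δ_pos]

lemma one_le_N_mul (P : VaughanParams N V q a α Δ Y R) : 1 ≤ N * Δ := by
  nlinarith [P.one_le, P.Δ_le_one, P.Δ_pos, P.one_le_N_real, mul_pos P.Δ_pos P.Δ_pos]

lemma V_pow_four_le (P : VaughanParams N V q a α Δ Y R) : V ^ 4 ≤ N := by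
  have h1 : (Δ * (V : ℝ) ^ 2) ^ 2 ≤ 1 :=
    pow_le_one₀ (mul_nonneg P.Δ_pos.le (by positivity)) P.V_le
  have h2 : ((V : ℝ)) ^ 4 ≤ N := by
    have h3 : (V : ℝ) ^ 4 * 1 ≤ (V : ℝ) ^ 4 * (N * Δ ^ 2) := by
      gcongr
      exact P.one_le
    have h4 : N * (Δ * (V : ℝ) ^ 2) ^ 2 ≤ N * 1 := by gcongr
    nlinarith
  exact_mod_cast h2

lemma V_sq_mul_N_le (P : VaughanParams N V q a α Δ Y R) : (V : ℝ) ^ 2 * N ≤ R ^ 2 := by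
  refine le_of_sq_le_sq ?_ (sq_nonneg R)
  rw [← pow_mul, P.R_pow]
  have hΔ := P.Δ_pos
  have h1 : (Δ * (V : ℝ) ^ 2) ^ 2 ≤ 1 := pow_le_one₀ (by positivity) P.V_le
  have h2 : (1 : ℝ) ≤ N ^ 2 * Δ ^ 3 := by
    calc (1 : ℝ) ≤ (N * Δ ^ 2) ^ 2 := one_le_pow₀ P.one_le
      _ = N ^ 2 * Δ ^ 3 * Δ := by ring
      _ ≤ N ^ 2 * Δ ^ 3 * 1 := by
        gcongr
        exact P.Δ_le_one
      _ = _ := mul_one _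
  have h3 : Δ ^ 2 * ((V : ℝ) ^ 2 * N) ^ 2 ≤ Δ ^ 2 * (N ^ 4 * Δ) := by
    calc Δ ^ 2 * ((V : ℝ) ^ 2 * N) ^ 2 = (Δ * (V : ℝ) ^ 2) ^ 2 * N ^ 2 := by ring
      _ ≤ (N ^ 2 * Δ ^ 3) * N ^ 2 := by gcongr; exact h1.trans h2
      _ = _ := by ring
  exact le_of_mul_le_mul_left h3 (by positivity)

lemma V_mul_le (P : VaughanParams N V q a α Δ Y R) : (V : ℝ) * (N ^ 2 * Δ) ≤ R ^ 2 := by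
  refine le_of_sq_le_sq ?_ (sq_nonneg R)
  rw [← pow_mul, P.R_pow]
  have hΔ := P.Δ_pos
  calc ((V : ℝ) * (N ^ 2 * Δ)) ^ 2 = (Δ * V ^ 2) * (N ^ 4 * Δ) := by ring
    _ ≤ 1 * (N ^ 4 * Δ) := by gcongr; exact P.V_le
    _ = _ := one_mul _

lemma div_q_le (P : VaughanParams N V q a α Δ Y R) {x : ℝ} (hx : 0 ≤ x) : x / q ≤ x * Δ := by
  have : (0 : ℝ) < q := by exact_mod_cast P.q_pos
  rw [div_le_iff₀ this]
  nlinarith [P.inv_q_le]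

lemma typeII_block (P : VaughanParams N V q a α Δ Y R) {M K : ℕ} (hM : 0 < M)
    (hMV : M * V ≤ N) (hMK : M * K ≤ N) (hK : K ≤ 2 * M) {x y : ℕ → ℂ} (hx : ∀ m, ‖x m‖ ≤ Y)
    (hy : ∀ k, ‖y k‖ ≤ Y) (l u : ℕ → ℕ) :
    ‖∑ m ∈ Finset.Ico M (2 * M), ∑ k ∈ Finset.Icc 1 K,
      if l k ≤ m ∧ m < u k then x m * y k * e2pi (α * ((m * k : ℕ) : ℝ) ^ 2) else 0‖ ≤
      6 * Y ^ 3 * R := by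
  have hY := P.one_le_Y
  have hΔ := P.Δ_pos
  have hR := P.R_nonneg
  have hq : (0 : ℝ) < q := by exact_mod_cast P.q_pos
  have hKN : K ≤ N := (Nat.le_mul_of_pos_left K hM).trans hMK
  have hrange : 2 * M * K ^ 2 ≤ 8 * N ^ 2 := by
    calc 2 * M * K ^ 2 = 2 * ((M * K) * K) := by ring
      _ ≤ 2 * (N * N) := by gcongr
      _ ≤ 8 * N ^ 2 := by nlinarith
  have hT : ∀ j ∈ Finset.Icc 1 (2 * M * K ^ 2), (j.divisors.card : ℝ) ≤ Y := fun j hj =>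
    P.divisors_le j (Finset.Icc_subset_Icc_right hrange hj)
  have hblock := typeII_block_le α hx hy l u hT
  have hQ := sum_distKernel_le M (2 * M * K ^ 2) P.q_pos P.approx P.gcd_eq
  have hMVr : (M : ℝ) * V ≤ N := by exact_mod_cast hMV
  have hMKr : (M : ℝ) * K ≤ N := by exact_mod_cast hMK
  have hKr : (K : ℝ) ≤ 2 * M := by exact_mod_cast hK
  have hMr : (1 : ℝ) ≤ M := by exact_mod_cast hM
  have hK0 : (0 : ℝ) ≤ K := by positivity
  have hN1 := P.one_le_N_real
  have hNΔ : (N : ℝ) ≤ N ^ 2 * Δ := by nlinarith [P.one_le_N_mul]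
  have hKΔ : (K : ℝ) ≤ 2 * (N * Δ) := by
    refine le_of_sq_le_sq ?_ (by positivity)
    nlinarith [P.one_le]
  have hMKK : (M : ℝ) * K ^ 2 ≤ 2 * (N ^ 2 * Δ) := by
    calc (M : ℝ) * K ^ 2 = (M * K) * K := by ring
      _ ≤ N * (2 * (N * Δ)) := by gcongr
      _ = _ := by ring
  have hMK2 : (M : ℝ) ^ 2 * K ^ 2 ≤ N ^ 2 := by
    rw [← mul_pow]
    gcongr
  have hM_le : (M : ℝ) ≤ N ^ 2 * Δ := by
    have : (1 : ℝ) ≤ V := by exact_mod_cast P.V_pos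
    nlinarith
  set Q := ∑ j ∈ Finset.Icc (1 : ℕ) (2 * M * K ^ 2), distKernel M (α * (j : ℝ)) with hQdef
  have hQ' : Q ≤ 22 * Y * (N ^ 2 * Δ) := by
    calc Q ≤ _ := hQ
      _ ≤ (((2 * M * K ^ 2 : ℕ) : ℝ) / q + 1) * (4 * M + 2 * q * Y) := by
        gcongr
        exact P.log_q_le
      _ = 8 * (M ^ 2 * K ^ 2 / q) + 4 * (M * K ^ 2) * Y + 4 * M + 2 * q * Y := by
        push_cast
        field_simp
        ring
      _ ≤ 8 * (N ^ 2 * Δ) + 4 * (2 * (N ^ 2 * Δ)) * Y + 4 * (N ^ 2 * Δ) + 2 * (N ^ 2 * Δ) * Y := by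
        gcongr
        · exact (P.div_q_le (by positivity)).trans (by gcongr)
        · exact P.q_le
      _ ≤ 22 * Y * (N ^ 2 * Δ) := by
        have : 0 ≤ (N : ℝ) ^ 2 * Δ := by positivity
        nlinarith
  have hfirst : (M : ℝ) ^ 4 * K ^ 2 ≤ 4 * (N ^ 4 * Δ) := by
    have h1 : (M : ℝ) ^ 2 ≤ 4 * Δ * N ^ 2 := by
      calc (M : ℝ) ^ 2 = M ^ 2 * 1 := (mul_one _).symm
        _ ≤ M ^ 2 * (4 * Δ * V ^ 2) := by gcongr; exact P.le_V
        _ = 4 * Δ * (M * V) ^ 2 := by ring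
        _ ≤ _ := by gcongr
    calc (M : ℝ) ^ 4 * K ^ 2 = M ^ 2 * (M ^ 2 * K ^ 2) := by ring
      _ ≤ (4 * Δ * N ^ 2) * N ^ 2 := by gcongr
      _ = _ := by ring
  have hsecond : (M : ℝ) ^ 2 * (K ^ 2 * (K ^ 2 * M + 4 * (Y ^ 2 * Q))) ≤
      90 * Y ^ 3 * (N ^ 4 * Δ) := by
    calc (M : ℝ) ^ 2 * (K ^ 2 * (K ^ 2 * M + 4 * (Y ^ 2 * Q)))
        = (M ^ 2 * K ^ 2) * (M * K ^ 2 + 4 * (Y ^ 2 * Q)) := by ring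
      _ ≤ N ^ 2 * (2 * (N ^ 2 * Δ) + 4 * (Y ^ 2 * (22 * Y * (N ^ 2 * Δ)))) := by
        have : 0 ≤ Q := Finset.sum_nonneg fun _ _ => distKernel_nonneg _ _
        gcongr
      _ = (2 + 88 * Y ^ 3) * (N ^ 4 * Δ) := by ring
      _ ≤ 90 * Y ^ 3 * (N ^ 4 * Δ) := by
        have : 1 ≤ Y ^ 3 := one_le_pow₀ hY
        gcongr
        linarith
  refine le_of_pow_le_pow_left₀ four_ne_zero (by positivity) (hblock.trans ?_)
  calc Y ^ 4 * Y ^ 4 * (2 * M ^ 4 * K ^ 2 + 8 * (M ^ 2 * (K ^ 2 * (K ^ 2 * M +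
        4 * (Y ^ 2 * Q)))))
      = Y ^ 8 * (2 * (M ^ 4 * K ^ 2) + 8 * (M ^ 2 * (K ^ 2 * (K ^ 2 * M +
        4 * (Y ^ 2 * Q))))) := by ring
    _ ≤ Y ^ 8 * (2 * (4 * (N ^ 4 * Δ)) + 8 * (90 * Y ^ 3 * (N ^ 4 * Δ))) := by gcongr
    _ = Y ^ 8 * ((8 + 720 * Y ^ 3) * (N ^ 4 * Δ)) := by ring
    _ ≤ Y ^ 8 * ((1296 * Y ^ 4) * (N ^ 4 * Δ)) := by
      have h1 : 1 ≤ Y ^ 3 := one_le_pow₀ hY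
      have h2 : Y ^ 3 ≤ Y ^ 4 := pow_le_pow_right₀ hY (by norm_num)
      gcongr
      linarith
    _ = (6 * Y ^ 3 * R) ^ 4 := by
      rw [mul_pow, P.R_pow]
      ring

lemma typeI_block (P : VaughanParams N V q a α Δ Y R) {D H : ℕ} (hD : 0 < D) (hDV : D ≤ V)
    (hDH : D * H ≤ N) {r : ℕ → ℝ} (hr : ∀ d ∈ Finset.Ico D (2 * D), r d ^ 2 ≤
      H + 4 * ∑ h ∈ Finset.Icc 1 H, distKernel H (α * (d : ℝ) ^ 2 * (2 * h : ℕ))) :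
    ∑ d ∈ Finset.Ico D (2 * D), r d ≤ 15 * Y ^ 2 * R := by
  have hY := P.one_le_Y
  have hΔ := P.Δ_pos
  have hR := P.R_nonneg
  have hq : (0 : ℝ) < q := by exact_mod_cast P.q_pos
  have hVN : V ≤ N := (Nat.le_self_pow four_ne_zero V).trans P.V_pow_four_le
  have hrange : 8 * D ^ 2 * H ≤ 8 * N ^ 2 := by
    calc 8 * D ^ 2 * H = 8 * (D * (D * H)) := by ring
      _ ≤ 8 * (N * N) := by gcongr; exact hDV.trans hVN
      _ = 8 * N ^ 2 := by ring
  have hblock := typeI_block_le hD α hr fun j hj =>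
    P.divisors_le j (Finset.Icc_subset_Icc_right hrange hj)
  have hQ := sum_distKernel_le H (8 * D ^ 2 * H) P.q_pos P.approx P.gcd_eq
  have hDr : (1 : ℝ) ≤ D := by exact_mod_cast hD
  have hDVr : (D : ℝ) ≤ V := by exact_mod_cast hDV
  have hDHr : (D : ℝ) * H ≤ N := by exact_mod_cast hDH
  have hV1 : (1 : ℝ) ≤ V := by exact_mod_cast P.V_pos
  have hVV : (V : ℝ) ≤ V ^ 2 := by nlinarith
  have hN1 := P.one_le_N_real
  have hVN1 : (V : ℝ) * N ≤ R ^ 2 :=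
    (mul_le_mul_of_nonneg_right hVV (by positivity)).trans P.V_sq_mul_N_le
  have hN2 : (N : ℝ) ≤ R ^ 2 := by nlinarith
  set Q := ∑ j ∈ Finset.Icc (1 : ℕ) (8 * D ^ 2 * H), distKernel H (α * (j : ℝ)) with hQdef
  have hDQ : D * Q ≤ 54 * Y * R ^ 2 := by
    calc D * Q ≤ D * ((((8 * D ^ 2 * H : ℕ) : ℝ) / q + 1) * (4 * H + 2 * q * Y)) := by
          gcongr
          refine hQ.trans ?_
          gcongr
          exact P.log_q_le
      _ = 32 * (D * ((D * H) ^ 2 / q)) + 16 * (D ^ 2 * (D * H)) * Y + 4 * (D * H) +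
          2 * (D * q) * Y := by
        push_cast
        field_simp
        ring
      _ ≤ 32 * (V * (N ^ 2 * Δ)) + 16 * (V ^ 2 * N) * Y + 4 * N + 2 * (V * (N ^ 2 * Δ)) * Y := by
        gcongr
        · exact (P.div_q_le (by positivity)).trans (by gcongr)
        · exact P.q_le
      _ ≤ 32 * R ^ 2 + 16 * R ^ 2 * Y + 4 * R ^ 2 + 2 * R ^ 2 * Y := by
        have h1 := P.V_mul_le
        have h2 := P.V_sq_mul_N_le
        gcongr
      _ ≤ 54 * Y * R ^ 2 := by nlinarith [sq_nonneg R]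
  refine le_of_sq_le_sq ?_ (by positivity)
  calc (∑ d ∈ Finset.Ico D (2 * D), r d) ^ 2 ≤ _ := hblock
    _ = D * (D * H) + 4 * Y ^ 2 * (D * Q) := by ring
    _ ≤ R ^ 2 + 4 * Y ^ 2 * (54 * Y * R ^ 2) := by
      gcongr
      exact (mul_le_mul hDVr hDHr (by positivity) (by positivity)).trans hVN1
    _ = (1 + 216 * Y ^ 3) * R ^ 2 := by ring
    _ ≤ (225 * Y ^ 4) * R ^ 2 := by
      have h1 : 1 ≤ Y ^ 3 := one_le_pow₀ hY
      have h2 : Y ^ 3 ≤ Y ^ 4 := pow_le_pow_right₀ hY (by norm_num)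
      gcongr
      linarith
    _ = (15 * Y ^ 2 * R) ^ 2 := by ring

end VaughanParams

lemma sum_Icc_eq_sum_dyadic {N : ℕ} {g : ℕ → ℂ} (hg : ∀ m, N < m → g m = 0) :
    ∑ m ∈ Finset.Icc 1 N, g m =
      ∑ i ∈ Finset.range (Nat.log 2 N + 1), ∑ m ∈ Finset.Ico (2 ^ i) (2 * 2 ^ i), g m := by
  have h1 : ∀ n : ℕ, ∑ m ∈ Finset.Ico 1 (2 ^ n), g m =
      ∑ i ∈ Finset.range n, ∑ m ∈ Finset.Ico (2 ^ i) (2 * 2 ^ i), g m := by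
    intro n
    induction n with
    | zero => simp
    | succ n ih =>
      rw [Finset.sum_range_succ, ← ih, pow_succ', Finset.sum_Ico_consecutive _ Nat.one_le_two_pow
        (by omega)]
  rw [← h1]
  have h2 := Nat.lt_pow_succ_log_self one_lt_two N
  refine Finset.sum_subset ?_ ?_
  · intro m hm
    simp only [Finset.mem_Icc, Finset.mem_Ico] at hm ⊢
    exact ⟨hm.1, hm.2.trans_lt h2⟩
  · intro m hm hm'
    simp only [Finset.mem_Icc, Finset.mem_Ico] at hm hm'
    exact hg m (by omega)

lemma sum_log_mul_norm_le {H : ℕ} {g : ℕ → ℂ} {W : ℝ}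
    (hW : ∀ A B, B ≤ A + H → ‖∑ m ∈ Finset.Ico A B, g m‖ ≤ W) :
    ‖∑ m ∈ Finset.Icc 1 H, (Real.log m : ℂ) * g m‖ ≤ Real.log H * W := by
  rcases Nat.eq_zero_or_pos H with rfl | hH
  · simp
  set δ : ℕ → ℝ := fun j => Real.log ((j + 1 : ℕ) : ℝ) - Real.log j with hδ
  have hlog : ∀ m : ℕ, 1 ≤ m → Real.log m = ∑ j ∈ Finset.Ico 1 m, δ j := by
    intro m hm
    rw [hδ, Finset.sum_Ico_sub (fun j : ℕ => Real.log (j : ℝ)) hm]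
    simp
  have hδ0 : ∀ j ∈ Finset.Ico 1 H, 0 ≤ δ j := by
    intro j hj
    have : 1 ≤ j := (Finset.mem_Ico.mp hj).1
    have h1 : (0 : ℝ) < j := by exact_mod_cast this
    refine sub_nonneg.mpr (Real.log_le_log h1 ?_)
    push_cast
    linarith
  have hswap : ∑ m ∈ Finset.Icc 1 H, (Real.log m : ℂ) * g m =
      ∑ j ∈ Finset.Ico 1 H, (δ j : ℂ) * ∑ m ∈ Finset.Ico (j + 1) (H + 1), g m := by
    have h1 : ∀ m ∈ Finset.Icc 1 H, (Real.log m : ℂ) * g m =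
        ∑ j ∈ Finset.Ico 1 m, (δ j : ℂ) * g m := by
      intro m hm
      rw [hlog m (Finset.mem_Icc.mp hm).1, Complex.ofReal_sum, Finset.sum_mul]
    simp only [Finset.mul_sum]
    rw [Finset.sum_congr rfl h1]
    refine Finset.sum_comm' fun m j => ?_
    simp only [Finset.mem_Icc, Finset.mem_Ico]
    omega
  rw [hswap, hlog H hH, Finset.sum_mul]
  refine norm_sum_le_of_le _ fun j hj => ?_
  rw [norm_mul, Complex.norm_real, Real.norm_eq_abs, abs_of_nonneg (hδ0 j hj)]
  exact mul_le_mul_of_nonneg_left (hW _ _ (by omega)) (hδ0 j hj)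

/-- The sum of `F m * G k * f (m * k)` over positive integers with `m * k ≤ N`. -/
noncomputable def hyperbolicSum (N : ℕ) (f F G : ℕ → ℂ) : ℂ :=
  ∑ m ∈ Finset.Icc 1 N, ∑ k ∈ Finset.Icc 1 N, if m * k ≤ N then F m * G k * f (m * k) else 0

lemma hyperbolicSum_eq_sum_mul (N : ℕ) (f F G : ℕ → ℂ) :
    hyperbolicSum N f F G =
      ∑ d ∈ Finset.Icc 1 N, F d * ∑ m ∈ Finset.Icc 1 (N / d), G m * f (d * m) := by
  refine Finset.sum_congr rfl fun d hd => ?_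
  have hd1 : 0 < d := (Finset.mem_Icc.mp hd).1
  have h1 : Finset.Icc 1 (N / d) = (Finset.Icc 1 N).filter (fun k => d * k ≤ N) := by
    ext k
    simp only [Finset.mem_Icc, Finset.mem_filter, Nat.le_div_iff_mul_le hd1]
    rw [mul_comm k d]
    refine ⟨fun h => ⟨⟨h.1, (Nat.le_mul_of_pos_left k hd1).trans h.2⟩, h.2⟩,
      fun h => ⟨h.1.1, h.2⟩⟩
  rw [h1, Finset.sum_filter, Finset.mul_sum]
  refine Finset.sum_congr rfl fun k _ => ?_
  split_ifs <;> ring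

lemma sum_arithmeticFunction_mul (N : ℕ) (f : ℕ → ℂ) (F G : ArithmeticFunction ℝ) :
    ∑ n ∈ Finset.Icc 1 N, ((F * G) n : ℂ) * f n =
      hyperbolicSum N f (fun m => (F m : ℂ)) (fun k => (G k : ℂ)) := by
  have h1 : ∀ n ∈ Finset.Icc 1 N, ((F * G) n : ℂ) * f n =
      ∑ p ∈ Finset.Icc 1 N ×ˢ Finset.Icc 1 N,
        if p.1 * p.2 = n then (F p.1 : ℂ) * G p.2 * f (p.1 * p.2) else 0 := by
    intro n hn
    obtain ⟨hn1, hn2⟩ := Finset.mem_Icc.mp hn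
    have h2 : n.divisorsAntidiagonal =
        (Finset.Icc 1 N ×ˢ Finset.Icc 1 N).filter (fun p => p.1 * p.2 = n) := by
      ext ⟨u, v⟩
      simp only [Nat.mem_divisorsAntidiagonal, Finset.mem_filter, Finset.mem_product,
        Finset.mem_Icc]
      constructor
      · rintro ⟨rfl, -⟩
        have hu : 0 < u := Nat.pos_of_ne_zero fun h => by simp [h] at hn1
        have hv : 0 < v := Nat.pos_of_ne_zero fun h => by simp [h] at hn1
        exact ⟨⟨⟨hu, (Nat.le_mul_of_pos_right u hv).trans hn2⟩, hv,
          (Nat.le_mul_of_pos_left v hu).trans hn2⟩, rfl⟩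
      · rintro ⟨-, h⟩
        exact ⟨h, by omega⟩
    rw [ArithmeticFunction.mul_apply, h2, ← Finset.sum_filter, Complex.ofReal_sum, Finset.sum_mul]
    refine Finset.sum_congr rfl fun p hp => ?_
    rw [(Finset.mem_filter.mp hp).2, Complex.ofReal_mul]
  rw [Finset.sum_congr rfl h1, Finset.sum_comm, Finset.sum_product]
  refine Finset.sum_congr rfl fun m hm => Finset.sum_congr rfl fun k hk => ?_
  have : 1 ≤ m * k :=
    Nat.mul_pos (Finset.mem_Icc.mp hm).1 (Finset.mem_Icc.mp hk).1
  simp only [Finset.sum_ite_eq, Finset.mem_Icc, this, true_and]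

namespace VaughanParams

variable {N V q : ℕ} {a : ℤ} {α Δ Y R : ℝ}

lemma norm_sum_range_log_le (P : VaughanParams N V q a α Δ Y R) {g : ℕ → ℂ} {Z : ℝ}
    (hZ : 0 ≤ Z) (hg : ∀ i, ‖g i‖ ≤ Z) :
    ‖∑ i ∈ Finset.range (Nat.log 2 N + 1), g i‖ ≤ Y * Z := by
  refine (norm_sum_le_of_le _ fun i _ => hg i).trans ?_
  rw [Finset.sum_const, Finset.card_range, nsmul_eq_mul]
  exact mul_le_mul_of_nonneg_right P.natLog_le hZ

lemma typeII_ordered (P : VaughanParams N V q a α Δ Y R) {x y : ℕ → ℂ} (hx : ∀ m, ‖x m‖ ≤ Y)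
    (hy : ∀ k, ‖y k‖ ≤ Y)
    (hV : ∀ m k, m * k ≤ N → x m ≠ 0 → y k ≠ 0 → m * V ≤ N) {l : ℕ → ℕ} (hl : ∀ k, k ≤ l k) :
    ‖∑ m ∈ Finset.Icc 1 N, ∑ k ∈ Finset.Icc 1 N,
      if l k ≤ m ∧ m < N / k + 1 then x m * y k * e2pi (α * ((m * k : ℕ) : ℝ) ^ 2) else 0‖ ≤
      6 * Y ^ 4 * R := by
  have hY : 0 ≤ Y := zero_le_one.trans P.one_le_Y
  have hR := P.R_nonneg
  rw [sum_Icc_eq_sum_dyadic]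
  · refine (P.norm_sum_range_log_le (Z := 6 * Y ^ 3 * R) (by positivity) fun i => ?_).trans
      (le_of_eq (by ring))
    have hM : 0 < 2 ^ i := by positivity
    generalize 2 ^ i = M at hM
    have hmul : ∀ {m k : ℕ}, k ∈ Finset.Icc 1 N → m < N / k + 1 → m * k ≤ N := fun hk h =>
      (Nat.le_div_iff_mul_le (Finset.mem_Icc.mp hk).1).mp (Nat.lt_succ_iff.mp h)
    by_cases hMV : M * V ≤ N
    · have hMK : M * min (2 * M) (N / M) ≤ N :=
        (Nat.mul_le_mul_left M (min_le_right _ _)).trans (Nat.mul_div_le N M)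
      have hKN : min (2 * M) (N / M) ≤ N := (min_le_right _ _).trans (Nat.div_le_self _ _)
      refine le_of_eq_of_le ?_ (P.typeII_block hM hMV hMK (min_le_left _ _) hx hy l
        (fun k => N / k + 1))
      congr 1
      refine Finset.sum_congr rfl fun m hm => Eq.symm ?_
      refine Finset.sum_subset (Finset.Icc_subset_Icc_right hKN) fun k hk hk' => ?_
      refine if_neg fun h => hk' ?_
      have hm' := Finset.mem_Ico.mp hm
      have h1 := hmul hk h.2
      have h2 := hl k
      refine Finset.mem_Icc.mpr ⟨(Finset.mem_Icc.mp hk).1, le_min (by omega) ?_⟩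
      rw [Nat.le_div_iff_mul_le hM, mul_comm]
      exact (Nat.mul_le_mul_right k hm'.1).trans h1
    · rw [Finset.sum_eq_zero, norm_zero]
      · positivity
      · intro m hm
        refine Finset.sum_eq_zero fun k hk => ?_
        split_ifs with h
        · by_contra hne
          have h1 := hV m k (hmul hk h.2) (fun h0 => hne (by rw [h0]; ring))
            (fun h0 => hne (by rw [h0]; ring))
          exact hMV ((Nat.mul_le_mul_right V (Finset.mem_Ico.mp hm).1).trans h1)
        · rfl
  · intro m hm
    refine Finset.sum_eq_zero fun k _ => if_neg fun h => ?_
    have := Nat.div_le_self N k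
    omega

lemma typeII (P : VaughanParams N V q a α Δ Y R) {x y : ℕ → ℂ}
    (hx : ∀ m ∈ Finset.Icc 1 N, ‖x m‖ ≤ Y) (hy : ∀ k ∈ Finset.Icc 1 N, ‖y k‖ ≤ Y)
    (hV : ∀ m k, m * k ≤ N → x m ≠ 0 → y k ≠ 0 → m * V ≤ N ∧ k * V ≤ N) :
    ‖hyperbolicSum N (fun n => e2pi (α * (n : ℝ) ^ 2)) x y‖ ≤ 12 * Y ^ 4 * R := by
  have hY : 0 ≤ Y := zero_le_one.trans P.one_le_Y
  set x' : ℕ → ℂ := fun m => if m ∈ Finset.Icc 1 N then x m else 0 with hx'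
  set y' : ℕ → ℂ := fun m => if m ∈ Finset.Icc 1 N then y m else 0 with hy'
  have hx1 : ∀ m, ‖x' m‖ ≤ Y := by
    intro m
    simp only [hx']
    split_ifs with h
    · exact hx m h
    · simpa using hY
  have hy1 : ∀ m, ‖y' m‖ ≤ Y := by
    intro m
    simp only [hy']
    split_ifs with h
    · exact hy m h
    · simpa using hY
  have hx0 : ∀ m, x' m ≠ 0 → x m ≠ 0 := by
    intro m h h0
    simp [hx', h0] at h
  have hy0 : ∀ m, y' m ≠ 0 → y m ≠ 0 := by
    intro m h h0
    simp [hy', h0] at h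
  have h1 := P.typeII_ordered hx1 hy1
    (fun m k h hm hk => (hV m k h (hx0 m hm) (hy0 k hk)).1) (l := fun k => k) fun k => le_rfl
  have h2 := P.typeII_ordered hy1 hx1
    (fun k m h hk hm => (hV m k (by rwa [mul_comm]) (hx0 m hm) (hy0 k hk)).2)
    (l := fun k => k + 1) fun k => Nat.le_succ k
  rw [Finset.sum_comm] at h2
  refine le_trans (le_of_eq_of_le ?_ (norm_add_le _ _)) ((add_le_add h1 h2).trans (by linarith))
  congr 1
  rw [hyperbolicSum, ← Finset.sum_add_distrib]
  refine Finset.sum_congr rfl fun m hm => ?_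
  rw [← Finset.sum_add_distrib]
  refine Finset.sum_congr rfl fun k hk => ?_
  have ex : x' m = x m := if_pos hm
  have ey : y' k = y k := if_pos hk
  have c1 : m < N / k + 1 ↔ m * k ≤ N := by
    rw [Nat.lt_succ_iff, Nat.le_div_iff_mul_le (Finset.mem_Icc.mp hk).1]
  have c2 : k < N / m + 1 ↔ m * k ≤ N := by
    rw [Nat.lt_succ_iff, Nat.le_div_iff_mul_le (Finset.mem_Icc.mp hm).1, mul_comm]
  simp only [ex, ey, c1, c2]
  by_cases c : m * k ≤ N
  · by_cases o : k ≤ m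
    · rw [if_pos c, if_pos ⟨o, c⟩, if_neg (by omega), add_zero]
    · rw [if_pos c, if_neg (fun h => o h.1), if_pos ⟨by omega, c⟩, zero_add, mul_comm k m,
        mul_comm (y k)]
  · rw [if_neg c, if_neg (fun h => c h.2), if_neg (fun h => c h.2), add_zero]

lemma typeI (P : VaughanParams N V q a α Δ Y R) {z : ℕ → ℂ} (hz0 : ∀ d, V < d → z d = 0)
    (hz : ∀ d ∈ Finset.Icc 1 N, ∀ W : ℝ,
      (∀ A B, B ≤ A + N / d → ‖∑ m ∈ Finset.Ico A B, e2pi (α * (d : ℝ) ^ 2 * (m : ℝ) ^ 2)‖ ≤ W) →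
      ‖z d‖ ≤ Y ^ 2 * W) :
    ‖∑ d ∈ Finset.Icc 1 N, z d‖ ≤ 15 * Y ^ 5 * R := by
  have hY : 0 ≤ Y := zero_le_one.trans P.one_le_Y
  have hR := P.R_nonneg
  have hVN : V ≤ N := (Nat.le_self_pow four_ne_zero V).trans P.V_pow_four_le
  rw [sum_Icc_eq_sum_dyadic fun d hd => hz0 d (hVN.trans_lt hd)]
  refine (P.norm_sum_range_log_le (Z := Y ^ 2 * (15 * Y ^ 2 * R)) (by positivity)
    fun i => ?_).trans (le_of_eq (by ring))
  have hD : 0 < 2 ^ i := by positivity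
  generalize 2 ^ i = D at hD
  by_cases hDV : D ≤ V
  · set r : ℕ → ℝ := fun d => √(((N / D : ℕ) : ℝ) + 4 * ∑ h ∈ Finset.Icc 1 (N / D),
      distKernel (N / D) (α * (d : ℝ) ^ 2 * (2 * h : ℕ))) with hr
    have hpos : ∀ d : ℕ, 0 ≤ ((N / D : ℕ) : ℝ) + 4 * ∑ h ∈ Finset.Icc 1 (N / D),
        distKernel (N / D) (α * (d : ℝ) ^ 2 * (2 * h : ℕ)) := fun d =>
      add_nonneg (by positivity)
        (mul_nonneg (by norm_num) (Finset.sum_nonneg fun _ _ => distKernel_nonneg _ _))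
    have h1 := P.typeI_block hD hDV (Nat.mul_div_le N D) (r := r)
      fun d _ => (Real.sq_sqrt (hpos d)).le
    have h2 : ∀ d ∈ Finset.Ico D (2 * D), ‖z d‖ ≤ Y ^ 2 * r d := by
      intro d hd
      obtain ⟨hd1, hd2⟩ := Finset.mem_Ico.mp hd
      by_cases hdV : V < d
      · rw [hz0 d hdV, norm_zero]
        exact mul_nonneg (by positivity) (Real.sqrt_nonneg _)
      · refine hz d (Finset.mem_Icc.mpr ⟨by omega, by omega⟩) _ fun A B hAB =>
          Real.le_sqrt_of_sq_le (norm_weyl_sum_sq_le _ (hAB.trans ?_))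
        gcongr
    refine (norm_sum_le_of_le _ h2).trans ?_
    rw [← Finset.mul_sum]
    gcongr
  · rw [Finset.sum_eq_zero, norm_zero]
    · positivity
    · intro d hd
      have := (Finset.mem_Ico.mp hd).1
      exact hz0 d (by omega)

end VaughanParams

lemma ArithmeticFunction.sub_apply {R : Type*} [AddGroup R] (F G : ArithmeticFunction R) (n : ℕ) :
    (F - G) n = F n - G n := by
  rw [sub_eq_add_neg, sub_eq_add_neg]
  rfl

/-- The arithmetic function that agrees with `F` up to `V` and vanishes beyond. -/
noncomputable def truncate (F : ArithmeticFunction ℝ) (V : ℕ) : ArithmeticFunction ℝ :=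
  ⟨fun n => if n ≤ V then F n else 0, by simp⟩

lemma truncate_apply (F : ArithmeticFunction ℝ) (V n : ℕ) :
    truncate F V n = if n ≤ V then F n else 0 := rfl

lemma abs_truncate_le (F : ArithmeticFunction ℝ) (V n : ℕ) : |truncate F V n| ≤ |F n| := by
  rw [truncate_apply]
  split_ifs
  · exact le_rfl
  · simp

lemma abs_sub_truncate_le (F : ArithmeticFunction ℝ) (V n : ℕ) :
    |(F - truncate F V) n| ≤ |F n| := by
  rw [ArithmeticFunction.sub_apply, truncate_apply]
  split_ifs
  · simp
  · simp

lemma sub_truncate_eq_zero (F : ArithmeticFunction ℝ) {V n : ℕ} (h : n ≤ V) :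
    (F - truncate F V) n = 0 := by
  rw [ArithmeticFunction.sub_apply, truncate_apply, if_pos h, sub_self]

section Vaughan

open ArithmeticFunction ArithmeticFunction.Moebius ArithmeticFunction.zeta

/-- Vaughan's identity. -/
lemma vonMangoldt_eq_vaughan (V : ℕ) :
    (Λ : ArithmeticFunction ℝ) = truncate Λ V + truncate (μ : ArithmeticFunction ℝ) V * log
      - truncate (truncate Λ V * truncate (μ : ArithmeticFunction ℝ) V) V * (ζ : ArithmeticFunction ℝ)
      - (truncate Λ V * truncate (μ : ArithmeticFunction ℝ) V -
          truncate (truncate Λ V * truncate (μ : ArithmeticFunction ℝ) V) V) *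
        (ζ : ArithmeticFunction ℝ)
      + (Λ - truncate Λ V) *
        (((μ : ArithmeticFunction ℝ) - truncate (μ : ArithmeticFunction ℝ) V) *
          (ζ : ArithmeticFunction ℝ)) := by
  have h1 : (μ : ArithmeticFunction ℝ) * (ζ : ArithmeticFunction ℝ) = 1 := coe_moebius_mul_coe_zeta
  have h2 : Λ * (ζ : ArithmeticFunction ℝ) = log := vonMangoldt_mul_zeta
  linear_combination (truncate Λ V - Λ) * h1 + truncate (μ : ArithmeticFunction ℝ) V * h2

lemma abs_coe_moebius_le_one (n : ℕ) : |(μ : ArithmeticFunction ℝ) n| ≤ 1 := by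
  rw [intCoe_apply]
  exact_mod_cast abs_moebius_le_one (n := n)

lemma abs_truncate_vonMangoldt_mul_moebius_le (V n : ℕ) :
    |(truncate Λ V * truncate (μ : ArithmeticFunction ℝ) V) n| ≤ Real.log n := by
  rw [mul_apply, ← vonMangoldt_sum, ← Nat.map_div_right_divisors, Finset.sum_map]
  refine (Finset.abs_sum_le_sum_abs _ _).trans (Finset.sum_le_sum fun d _ => ?_)
  rw [abs_mul]
  calc |truncate Λ V d| * |truncate (μ : ArithmeticFunction ℝ) V (n / d)|
      ≤ |Λ d| * 1 := mul_le_mul (abs_truncate_le _ _ _)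
        ((abs_truncate_le _ _ _).trans (abs_coe_moebius_le_one _)) (abs_nonneg _) (abs_nonneg _)
    _ = Λ d := by rw [mul_one, abs_of_nonneg vonMangoldt_nonneg]

lemma le_sq_of_truncate_mul_truncate_ne_zero {F G : ArithmeticFunction ℝ} {V n : ℕ}
    (h : (truncate F V * truncate G V) n ≠ 0) : n ≤ V ^ 2 := by
  rw [mul_apply] at h
  obtain ⟨⟨u, v⟩, hp, hne⟩ := Finset.exists_ne_zero_of_sum_ne_zero h
  have huv := (Nat.mem_divisorsAntidiagonal.mp hp).1
  have hu : u ≤ V := by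
    by_contra hu
    exact hne (by simp [truncate_apply, hu])
  have hv : v ≤ V := by
    by_contra hv
    exact hne (by simp [truncate_apply, hv])
  rw [← huv, sq]
  exact Nat.mul_le_mul hu hv

lemma abs_sub_truncate_moebius_mul_zeta_le (V n : ℕ) :
    |(((μ : ArithmeticFunction ℝ) - truncate (μ : ArithmeticFunction ℝ) V) *
      (ζ : ArithmeticFunction ℝ)) n| ≤ n.divisors.card := by
  rw [coe_mul_zeta_apply]
  refine (Finset.abs_sum_le_sum_abs _ _).trans ?_
  rw [← nsmul_one, ← Finset.sum_const]
  exact Finset.sum_le_sum fun d _ => (abs_sub_truncate_le _ _ _).trans (abs_coe_moebius_le_one _)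

lemma sub_truncate_mul_zeta_eq_zero (F : ArithmeticFunction ℝ) {V n : ℕ} (h : n ≤ V) :
    ((F - truncate F V) * (ζ : ArithmeticFunction ℝ)) n = 0 := by
  rw [coe_mul_zeta_apply]
  exact Finset.sum_eq_zero fun d hd => sub_truncate_eq_zero F ((Nat.divisor_le hd).trans h)

lemma norm_sum_vonMangoldt_sub_sum_prime_le {N : ℕ} (hN : 1 ≤ N) {f : ℕ → ℂ}
    (hf : ∀ n, ‖f n‖ ≤ 1) :
    ‖∑ n ∈ Finset.Icc 1 N, (Λ n : ℂ) * f n -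
      ∑ p ∈ (Finset.range (N + 1)).filter Nat.Prime, f p * (Real.log p : ℂ)‖ ≤
      2 * √N * Real.log N := by
  have h1 : (Finset.range (N + 1)).filter Nat.Prime = (Finset.Icc 1 N).filter Nat.Prime := by
    ext p
    simp only [Finset.mem_filter, Finset.mem_range, Finset.mem_Icc]
    exact ⟨fun h => ⟨⟨h.2.one_le, by omega⟩, h.2⟩, fun h => ⟨by omega, h.2⟩⟩
  have h2 : ∑ p ∈ (Finset.Icc 1 N).filter Nat.Prime, f p * (Real.log p : ℂ) =
      ∑ p ∈ (Finset.Icc 1 N).filter Nat.Prime, (Λ p : ℂ) * f p := by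
    refine Finset.sum_congr rfl fun p hp => ?_
    rw [vonMangoldt_apply_prime (Finset.mem_filter.mp hp).2, mul_comm]
  rw [h1, h2, ← Finset.sum_filter_add_sum_filter_not (Finset.Icc 1 N) Nat.Prime,
    add_sub_cancel_left]
  refine le_trans ?_ (Chebyshev.psi_sub_theta_le (x := (N : ℝ)) (by exact_mod_cast hN))
  rw [Chebyshev.psi_sub_theta_eq_sum_not_prime, Nat.floor_natCast]
  refine norm_sum_le_of_le _ fun n _ => ?_
  rw [norm_mul, Complex.norm_real, Real.norm_eq_abs, abs_of_nonneg vonMangoldt_nonneg]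
  exact mul_le_of_le_one_right vonMangoldt_nonneg (hf n)

namespace VaughanParams

variable {N V q : ℕ} {a : ℤ} {α Δ Y R : ℝ}

lemma log_le (P : VaughanParams N V q a α Δ Y R) {n : ℕ} (h : n ≤ N) : Real.log n ≤ Y := by
  rcases Nat.eq_zero_or_pos n with rfl | hn
  · simpa using zero_le_one.trans P.one_le_Y
  · refine le_trans (Real.log_le_log (by exact_mod_cast hn) ?_) P.log_N_le
    exact_mod_cast h

lemma V_le_R (P : VaughanParams N V q a α Δ Y R) : (V : ℝ) ≤ R := by
  refine le_of_sq_le_sq (le_trans ?_ P.V_sq_mul_N_le) P.R_nonneg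
  exact le_mul_of_one_le_right (sq_nonneg _) P.one_le_N_real

lemma sqrt_N_le_R (P : VaughanParams N V q a α Δ Y R) : √(N : ℝ) ≤ R := by
  rw [Real.sqrt_le_left P.R_nonneg]
  refine le_trans ?_ P.V_sq_mul_N_le
  have h1 : (1 : ℝ) ≤ V := by exact_mod_cast P.V_pos
  exact le_mul_of_one_le_left (Nat.cast_nonneg _) (one_le_pow₀ h1)

lemma norm_sum_truncate_le (P : VaughanParams N V q a α Δ Y R) {f : ℕ → ℂ}
    (hf : ∀ n, ‖f n‖ ≤ 1) :
    ‖∑ n ∈ Finset.Icc 1 N, (truncate Λ V n : ℂ) * f n‖ ≤ Y * R := by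
  have hY : 0 ≤ Y := zero_le_one.trans P.one_le_Y
  have hVN : V ≤ N := (Nat.le_self_pow four_ne_zero V).trans P.V_pow_four_le
  have h1 : ∑ n ∈ Finset.Icc 1 N, (truncate Λ V n : ℂ) * f n =
      ∑ n ∈ Finset.Icc 1 V, (truncate Λ V n : ℂ) * f n := by
    refine (Finset.sum_subset (Finset.Icc_subset_Icc_right hVN) fun n hn hn' => ?_).symm
    simp only [Finset.mem_Icc] at hn hn'
    rw [truncate_apply, if_neg (by omega)]
    simp
  rw [h1]
  have h2 : ∀ n ∈ Finset.Icc 1 V, ‖(truncate Λ V n : ℂ) * f n‖ ≤ Y := by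
    intro n hn
    rw [norm_mul, Complex.norm_real, Real.norm_eq_abs]
    refine (mul_le_of_le_one_right (abs_nonneg _) (hf n)).trans ((abs_truncate_le _ _ _).trans ?_)
    rw [abs_of_nonneg vonMangoldt_nonneg]
    exact vonMangoldt_le_log.trans (P.log_le ((Finset.mem_Icc.mp hn).2.trans hVN))
  refine (norm_sum_le_of_le _ h2).trans ?_
  rw [Finset.sum_const, Nat.card_Icc, nsmul_eq_mul, add_tsub_cancel_right, mul_comm]
  exact mul_le_mul_of_nonneg_left P.V_le_R hY

lemma typeI_convolution (P : VaughanParams N V q a α Δ Y R) {F G : ArithmeticFunction ℝ}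
    (hF : ∀ d ∈ Finset.Icc 1 N, |F d| ≤ Y)
    (hG : ∀ H ≤ N, ∀ (g : ℕ → ℂ) (W : ℝ), (∀ A B, B ≤ A + H → ‖∑ m ∈ Finset.Ico A B, g m‖ ≤ W) →
      ‖∑ m ∈ Finset.Icc 1 H, (G m : ℂ) * g m‖ ≤ Y * W) :
    ‖∑ n ∈ Finset.Icc 1 N, ((truncate F V * G) n : ℂ) * e2pi (α * (n : ℝ) ^ 2)‖ ≤
      15 * Y ^ 5 * R := by
  have hY : 0 ≤ Y := zero_le_one.trans P.one_le_Y
  rw [sum_arithmeticFunction_mul N (fun n => e2pi (α * (n : ℝ) ^ 2)), hyperbolicSum_eq_sum_mul]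
  refine P.typeI (fun d hd => ?_) fun d hd W hW => ?_
  · rw [truncate_apply, if_neg (by omega)]
    simp
  · have h1 := hG (N / d) (Nat.div_le_self _ _)
      (fun m => e2pi (α * (d : ℝ) ^ 2 * (m : ℝ) ^ 2)) W hW
    rw [norm_mul, Complex.norm_real, Real.norm_eq_abs, sq, mul_assoc]
    refine mul_le_mul ((abs_truncate_le _ _ _).trans (hF d hd)) ?_ (norm_nonneg _) hY
    refine le_of_eq_of_le ?_ h1
    congr 1
    refine Finset.sum_congr rfl fun m _ => ?_
    rw [Nat.cast_mul, mul_pow, ← mul_assoc α]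

theorem norm_sum_prime_le (P : VaughanParams N V q a α Δ Y R) :
    ‖∑ p ∈ (Finset.range (N + 1)).filter Nat.Prime,
      e2pi (α * (p : ℝ) ^ 2) * (Real.log p : ℂ)‖ ≤ 57 * Y ^ 5 * R := by
  have hY1 := P.one_le_Y
  have hY : 0 ≤ Y := zero_le_one.trans hY1
  have hR := P.R_nonneg
  set f : ℕ → ℂ := fun n => e2pi (α * (n : ℝ) ^ 2) with hf
  have hf1 : ∀ n, ‖f n‖ ≤ 1 := fun n => (norm_e2pi _).le
  set g := truncate Λ V * truncate (μ : ArithmeticFunction ℝ) V with hg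
  set b := ((μ : ArithmeticFunction ℝ) - truncate (μ : ArithmeticFunction ℝ) V) *
    (ζ : ArithmeticFunction ℝ) with hb
  have hζ : ∀ m ∈ Finset.Icc 1 N, ((ζ : ArithmeticFunction ℝ) m) = 1 := fun m hm => by
    rw [natCoe_apply, zeta_apply_ne (by have := Finset.mem_Icc.mp hm; omega), Nat.cast_one]
  have hgY : ∀ d ∈ Finset.Icc 1 N, |g d| ≤ Y := fun d hd =>
    (abs_truncate_vonMangoldt_mul_moebius_le V d).trans (P.log_le (Finset.mem_Icc.mp hd).2)
  have hΛ := P.norm_sum_truncate_le hf1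
  have hlog := P.typeI_convolution (F := (μ : ArithmeticFunction ℝ)) (G := log)
    (fun d _ => (abs_coe_moebius_le_one d).trans hY1) fun H hH h W hW => by
      have hW0 : 0 ≤ W := (norm_nonneg _).trans (hW 0 0 (by omega))
      exact (sum_log_mul_norm_le hW).trans (mul_le_mul_of_nonneg_right (P.log_le hH) hW0)
  have hzeta := P.typeI_convolution (F := g) (G := (ζ : ArithmeticFunction ℝ)) hgY
    fun H hH h W hW => by
      have hW0 : 0 ≤ W := (norm_nonneg _).trans (hW 0 0 (by omega))
      have h1 := hW 1 (H + 1) (by omega)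
      rw [Finset.Ico_add_one_right_eq_Icc] at h1
      refine le_trans (le_of_eq_of_le ?_ h1) (le_mul_of_one_le_left hW0 hY1)
      congr 1
      refine Finset.sum_congr rfl fun m hm => ?_
      rw [hζ m (Finset.Icc_subset_Icc_right hH hm)]
      simp
  have hII : ‖hyperbolicSum N f (fun m => ((g - truncate g V) m : ℂ))
      (fun k => ((ζ : ArithmeticFunction ℝ) k : ℂ))‖ ≤ 12 * Y ^ 4 * R := by
    refine P.typeII (fun m hm => ?_) (fun k hk => ?_) fun m k hmk hm _ => ?_
    · rw [Complex.norm_real, Real.norm_eq_abs]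
      exact (abs_sub_truncate_le _ _ _).trans (hgY m hm)
    · rw [hζ k hk]
      simpa using hY1
    · have h1 : V < m := by
        by_contra h
        exact hm (by rw [sub_truncate_eq_zero g (not_lt.mp h), Complex.ofReal_zero])
      have h2 : m ≤ V ^ 2 := by
        refine le_sq_of_truncate_mul_truncate_ne_zero (F := Λ) (G := (μ : ArithmeticFunction ℝ)) ?_
        intro h
        refine hm ?_
        rw [Complex.ofReal_eq_zero, ← abs_nonpos_iff]
        exact (abs_sub_truncate_le _ _ _).trans (abs_nonpos_iff.mpr h)
      refine ⟨?_, (Nat.mul_le_mul_left k h1.le).trans (by rwa [mul_comm])⟩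
      calc m * V ≤ V ^ 2 * V := Nat.mul_le_mul_right V h2
        _ = V ^ 3 := by ring
        _ ≤ V ^ 4 := Nat.pow_le_pow_right P.V_pos (by norm_num)
        _ ≤ N := P.V_pow_four_le
  have hII' : ‖hyperbolicSum N f (fun m => ((Λ - truncate Λ V) m : ℂ)) (fun k => (b k : ℂ))‖ ≤
      12 * Y ^ 4 * R := by
    refine P.typeII (fun m hm => ?_) (fun k hk => ?_) fun m k hmk hm hk => ?_
    · rw [Complex.norm_real, Real.norm_eq_abs]
      refine (abs_sub_truncate_le _ _ _).trans ?_
      rw [abs_of_nonneg vonMangoldt_nonneg]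
      exact vonMangoldt_le_log.trans (P.log_le (Finset.mem_Icc.mp hm).2)
    · rw [Complex.norm_real, Real.norm_eq_abs]
      obtain ⟨hk1, hk2⟩ := Finset.mem_Icc.mp hk
      refine (abs_sub_truncate_moebius_mul_zeta_le V k).trans
        (P.divisors_le k (Finset.mem_Icc.mpr ⟨hk1, ?_⟩))
      nlinarith
    · have h1 : V < m := by
        by_contra h
        exact hm (by rw [sub_truncate_eq_zero Λ (not_lt.mp h), Complex.ofReal_zero])
      have h2 : V < k := by
        by_contra h
        exact hk (by rw [hb, sub_truncate_mul_zeta_eq_zero _ (not_lt.mp h), Complex.ofReal_zero])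
      exact ⟨(Nat.mul_le_mul_left m h2.le).trans hmk,
        (Nat.mul_le_mul_left k h1.le).trans (by rwa [mul_comm])⟩
  have hsplit : ∑ n ∈ Finset.Icc 1 N, (Λ n : ℂ) * f n =
      ∑ n ∈ Finset.Icc 1 N, (truncate Λ V n : ℂ) * f n
      + ∑ n ∈ Finset.Icc 1 N, ((truncate (μ : ArithmeticFunction ℝ) V * log) n : ℂ) * f n
      - ∑ n ∈ Finset.Icc 1 N, ((truncate g V * (ζ : ArithmeticFunction ℝ)) n : ℂ) * f n
      - hyperbolicSum N f (fun m => ((g - truncate g V) m : ℂ))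
        (fun k => ((ζ : ArithmeticFunction ℝ) k : ℂ))
      + hyperbolicSum N f (fun m => ((Λ - truncate Λ V) m : ℂ)) (fun k => (b k : ℂ)) := by
    rw [← sum_arithmeticFunction_mul, ← sum_arithmeticFunction_mul, ← Finset.sum_add_distrib,
      ← Finset.sum_sub_distrib, ← Finset.sum_sub_distrib, ← Finset.sum_add_distrib]
    refine Finset.sum_congr rfl fun n _ => ?_
    have h1 := congrArg (fun F : ArithmeticFunction ℝ => ((F n : ℝ) : ℂ)) (vonMangoldt_eq_vaughan V)
    simp only [ArithmeticFunction.add_apply, ArithmeticFunction.sub_apply (F := _ - _),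
      ArithmeticFunction.sub_apply (F := _ + _), Complex.ofReal_add, Complex.ofReal_sub] at h1
    rw [h1]
    ring
  have hpp := norm_sum_vonMangoldt_sub_sum_prime_le P.N_pos hf1
  have hpp' : 2 * √(N : ℝ) * Real.log N ≤ 2 * R * Y :=
    mul_le_mul (mul_le_mul_of_nonneg_left P.sqrt_N_le_R (by norm_num)) P.log_N_le
      (Real.log_natCast_nonneg _) (by positivity)
  have hsum : ‖∑ n ∈ Finset.Icc 1 N, (Λ n : ℂ) * f n‖ ≤
      Y * R + 15 * Y ^ 5 * R + 15 * Y ^ 5 * R + 12 * Y ^ 4 * R + 12 * Y ^ 4 * R := by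
    rw [hsplit]
    exact (norm_add_le _ _).trans (add_le_add ((norm_sub_le _ _).trans (add_le_add
      ((norm_sub_le _ _).trans (add_le_add ((norm_add_le _ _).trans (add_le_add hΛ hlog)) hzeta))
      hII)) hII')
  have hY5 : Y * R ≤ Y ^ 5 * R :=
    mul_le_mul_of_nonneg_right (le_self_pow₀ hY1 (by norm_num)) hR
  have hY4 : Y ^ 4 * R ≤ Y ^ 5 * R :=
    mul_le_mul_of_nonneg_right (pow_le_pow_right₀ hY1 (by norm_num)) hR
  have h1 := norm_sub_le (∑ n ∈ Finset.Icc 1 N, (Λ n : ℂ) * f n)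
    (∑ n ∈ Finset.Icc 1 N, (Λ n : ℂ) * f n -
      ∑ p ∈ (Finset.range (N + 1)).filter Nat.Prime, f p * (Real.log p : ℂ))
  rw [sub_sub_cancel] at h1
  linarith

end VaughanParams

end Vaughan

lemma exists_sq_cutoff {Δ : ℝ} (h0 : 0 < Δ) (h1 : Δ ≤ 1) :
    ∃ V : ℕ, 0 < V ∧ Δ * (V : ℝ) ^ 2 ≤ 1 ∧ 1 ≤ 4 * Δ * (V : ℝ) ^ 2 := by
  have hinv : 1 ≤ 1 / Δ := (one_le_div h0).mpr h1
  have hfloor : 1 ≤ ⌊1 / Δ⌋₊ := Nat.floor_pos.mpr hinv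
  have hV : 0 < Nat.sqrt ⌊1 / Δ⌋₊ := Nat.sqrt_pos.mpr hfloor
  refine ⟨Nat.sqrt ⌊1 / Δ⌋₊, hV, ?_, ?_⟩
  · have h2 : ((Nat.sqrt ⌊1 / Δ⌋₊ : ℕ) : ℝ) ^ 2 ≤ 1 / Δ :=
      le_trans (by exact_mod_cast Nat.sqrt_le' _) (Nat.floor_le (by positivity))
    rwa [le_div_iff₀' h0] at h2
  · have h2 : ⌊1 / Δ⌋₊ + 1 ≤ 4 * Nat.sqrt ⌊1 / Δ⌋₊ ^ 2 :=
      (Nat.succ_le_succ_sqrt' _).trans (by nlinarith)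
    have h3 : 1 / Δ ≤ 4 * ((Nat.sqrt ⌊1 / Δ⌋₊ : ℕ) : ℝ) ^ 2 :=
      (Nat.lt_floor_add_one _).le.trans (by exact_mod_cast h2)
    rw [div_le_iff₀ h0] at h3
    linarith

lemma exists_divisors_and_log_le_rpow {η : ℝ} (hη : 0 < η) :
    ∃ C : ℝ, 1 ≤ C ∧ ∀ n : ℕ, 1 ≤ n →
      (∀ j ∈ Finset.Icc 1 (8 * n ^ 2), (j.divisors.card : ℝ) ≤ C * (n : ℝ) ^ η) ∧
      1 + 2 * Real.log n ≤ C * (n : ℝ) ^ η := by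
  obtain ⟨C₀, hC₀, hdiv⟩ := exists_card_divisors_le_rpow (half_pos hη)
  have h8 : 0 ≤ C₀ * 8 ^ (η / 2) := by positivity
  have hη2 : 0 ≤ 2 / η := by positivity
  refine ⟨1 + 2 / η + C₀ * 8 ^ (η / 2), by linarith, fun n hn => ⟨fun j hj => ?_, ?_⟩⟩
  · obtain ⟨hj1, hj2⟩ := Finset.mem_Icc.mp hj
    have hj3 : (j : ℝ) ≤ 8 * (n : ℝ) ^ 2 := by exact_mod_cast hj2
    calc (j.divisors.card : ℝ) ≤ C₀ * (j : ℝ) ^ (η / 2) := hdiv j (by omega)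
      _ ≤ C₀ * (8 * (n : ℝ) ^ 2) ^ (η / 2) := by gcongr
      _ = C₀ * 8 ^ (η / 2) * (n : ℝ) ^ η := by
        rw [Real.mul_rpow (by norm_num) (by positivity), ← Real.rpow_natCast, ← Real.rpow_mul
          (Nat.cast_nonneg _), mul_assoc]
        congr 3
        push_cast
        ring
      _ ≤ (1 + 2 / η + C₀ * 8 ^ (η / 2)) * (n : ℝ) ^ η := by
        gcongr
        linarith
  · have hn1 : (1 : ℝ) ≤ (n : ℝ) ^ η := Real.one_le_rpow (by exact_mod_cast hn) hη.le
    have hlog : Real.log n ≤ (n : ℝ) ^ η / η := Real.log_le_rpow_div (Nat.cast_nonneg _) hη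
    calc 1 + 2 * Real.log n ≤ (n : ℝ) ^ η + 2 * ((n : ℝ) ^ η / η) := by linarith
      _ = (1 + 2 / η) * (n : ℝ) ^ η := by ring
      _ ≤ (1 + 2 / η + C₀ * 8 ^ (η / 2)) * (n : ℝ) ^ η :=
        mul_le_mul_of_nonneg_right (by linarith) (by linarith)

lemma natLog_two_le_two_mul_log (n : ℕ) : (Nat.log 2 n : ℝ) ≤ 2 * Real.log n := by
  have h1 : (Nat.log 2 n : ℝ) ≤ Real.logb 2 n := by exact_mod_cast Real.natLog_le_logb n 2
  refine h1.trans ?_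
  rw [Real.logb, div_le_iff₀ (Real.log_pos one_lt_two)]
  nlinarith [Real.log_natCast_nonneg n, Real.log_two_gt_d9]

lemma norm_sum_prime_le_trivial (n : ℕ) (α : ℝ) :
    ‖∑ p ∈ (Finset.range (n + 1)).filter Nat.Prime,
      e2pi (α * (p : ℝ) ^ 2) * (Real.log p : ℂ)‖ ≤ Real.log 4 * n := by
  refine le_trans ?_ (Chebyshev.theta_le_log4_mul_x (x := (n : ℝ)) (Nat.cast_nonneg n))
  rw [Chebyshev.theta, Nat.floor_natCast]
  have h1 : (Finset.range (n + 1)).filter Nat.Prime = (Finset.Ioc 0 n).filter Nat.Prime := by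
    ext p
    simp only [Finset.mem_filter, Finset.mem_range, Finset.mem_Ioc]
    exact ⟨fun h => ⟨⟨h.2.pos, by omega⟩, h.2⟩, fun h => ⟨by omega, h.2⟩⟩
  rw [h1]
  refine norm_sum_le_of_le _ fun p _ => ?_
  rw [norm_mul, norm_e2pi, one_mul, Complex.norm_real, Real.norm_eq_abs,
    abs_of_nonneg (Real.log_natCast_nonneg p)]

lemma exists_norm_sum_prime_le {ε : ℝ} (hε : 0 < ε) :
    ∃ C > 0, ∀ (n : ℕ) (α : ℝ) (a : ℤ) (q : ℕ), 1 ≤ n → 0 < q →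
      |α - (a : ℝ) / (q : ℝ)| ≤ 1 / (q : ℝ) ^ 2 → Int.gcd a (q : ℤ) = 1 →
      ‖∑ p ∈ (Finset.range (n + 1)).filter Nat.Prime,
          e2pi (α * (p : ℝ) ^ 2) * (Real.log p : ℂ)‖ ≤
      C * (n : ℝ) ^ (1 + ε) *
        (1 / (q : ℝ) + 1 / (n : ℝ) ^ ((1 : ℝ) / 2) + (q : ℝ) / (n : ℝ) ^ 2) ^ ((1 : ℝ) / 4) := by
  obtain ⟨C, hC, hY⟩ := exists_divisors_and_log_le_rpow (η := ε / 5) (by positivity)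
  have hlog4 : 0 ≤ Real.log 4 := Real.log_nonneg (by norm_num)
  refine ⟨Real.log 4 + 57 * C ^ 5, by positivity, fun n α a q hn hq hα hgcd => ?_⟩
  have hn' : (1 : ℝ) ≤ n := by exact_mod_cast hn
  have hn0 : (0 : ℝ) < n := by linarith
  have hq' : (1 : ℝ) ≤ q := by exact_mod_cast hq
  have hq0 : (0 : ℝ) < q := by linarith
  obtain ⟨hdiv, hlog⟩ := hY n hn
  set Δ : ℝ := 1 / (q : ℝ) + 1 / (n : ℝ) ^ ((1 : ℝ) / 2) + (q : ℝ) / (n : ℝ) ^ 2 with hΔ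
  have e1 : 0 < 1 / (q : ℝ) := by positivity
  have e2 : 0 < 1 / (n : ℝ) ^ ((1 : ℝ) / 2) := by positivity
  have e3 : 0 < (q : ℝ) / (n : ℝ) ^ 2 := by positivity
  have hΔ0 : 0 < Δ := by positivity
  rcases le_or_gt 1 Δ with h1 | h1
  · refine (norm_sum_prime_le_trivial n α).trans ?_
    calc Real.log 4 * n = Real.log 4 * (n : ℝ) ^ (1 : ℝ) * 1 := by rw [Real.rpow_one, mul_one]
      _ ≤ (Real.log 4 + 57 * C ^ 5) * (n : ℝ) ^ (1 + ε) * Δ ^ ((1 : ℝ) / 4) := by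
        gcongr
        · linarith [show 0 ≤ 57 * C ^ 5 by positivity]
        · linarith
        · exact Real.one_le_rpow h1 (by norm_num)
  · obtain ⟨V, hV0, hV1, hV2⟩ := exists_sq_cutoff hΔ0 h1.le
    have hqn : (q : ℝ) ≤ (n : ℝ) ^ 2 * Δ := by
      rw [← div_le_iff₀' (by positivity)]
      linarith
    have hlogn := Real.log_nonneg hn'
    have hlogq : Real.log q ≤ 2 * Real.log n := by
      have h2 : (q : ℝ) ≤ (n : ℝ) ^ 2 := hqn.trans (mul_le_of_le_one_right (by positivity) h1.le)
      simpa using Real.log_le_log hq0 h2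
    have P : VaughanParams n V q a α Δ (C * (n : ℝ) ^ (ε / 5)) (n * Δ ^ ((1 : ℝ) / 4)) :=
      { N_pos := hn
        q_pos := hq
        approx := hα
        gcd_eq := hgcd
        Δ_pos := hΔ0
        inv_q_le := by
          rw [← div_le_iff₀ hq0]
          linarith
        q_le := hqn
        one_le := by
          have h2 : (1 / (n : ℝ) ^ ((1 : ℝ) / 2)) ^ 2 ≤ Δ ^ 2 := by
            gcongr
            linarith
          rw [div_pow, one_pow, ← Real.rpow_mul_natCast hn0.le, div_le_iff₀ (by positivity)] at h2
          norm_num at h2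
          linarith
        V_pos := hV0
        V_le := hV1
        le_V := hV2
        one_le_Y := by linarith
        divisors_le := hdiv
        log_q_le := by linarith
        log_N_le := by linarith
        natLog_le := by
          push_cast
          linarith [natLog_two_le_two_mul_log n]
        R_nonneg := by positivity
        R_pow := by
          rw [mul_pow, ← Real.rpow_mul_natCast hΔ0.le]
          norm_num }
    refine P.norm_sum_prime_le.trans ?_
    have h5 : ((n : ℝ) ^ (ε / 5)) ^ 5 = (n : ℝ) ^ ε := by
      rw [← Real.rpow_mul_natCast hn0.le]
      norm_num
    calc 57 * (C * (n : ℝ) ^ (ε / 5)) ^ 5 * (n * Δ ^ ((1 : ℝ) / 4))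
        = 57 * C ^ 5 * (n : ℝ) ^ (1 + ε) * Δ ^ ((1 : ℝ) / 4) := by
          rw [mul_pow, h5, Real.rpow_add hn0, Real.rpow_one]
          ring
      _ ≤ (Real.log 4 + 57 * C ^ 5) * (n : ℝ) ^ (1 + ε) * Δ ^ ((1 : ℝ) / 4) := by
        gcongr
        linarith

theorem exp_sum_primes_squares_bound (ε : ℝ) (hε : 0 < ε) :
    ∃ C > 0, ∀ (N α : ℝ) (a : ℤ) (q : ℕ), 1 ≤ N → 0 < q →
      |α - (a : ℝ) / (q : ℝ)| ≤ 1 / (q : ℝ) ^ 2 → Int.gcd a (q : ℤ) = 1 →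
      ‖∑ p ∈ (Finset.range (⌊N⌋₊ + 1)).filter Nat.Prime,
          e2pi (α * (p : ℝ) ^ 2) * (Real.log p : ℂ)‖ ≤
      C * N ^ (1 + ε) *
        (1 / (q : ℝ) + 1 / N ^ ((1 : ℝ) / 2) + (q : ℝ) / N ^ 2) ^ ((1 : ℝ) / 4) := by
  obtain ⟨C, hC, h⟩ := exists_norm_sum_prime_le hε
  refine ⟨C * 4 ^ ((1 : ℝ) / 4), by positivity, fun N α a q hN hq hα hgcd => ?_⟩
  have hn : 1 ≤ ⌊N⌋₊ := Nat.floor_pos.mpr hN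
  refine (h ⌊N⌋₊ α a q hn hq hα hgcd).trans ?_
  have hN0 : 0 < N := by linarith
  have hnN : (⌊N⌋₊ : ℝ) ≤ N := Nat.floor_le hN0.le
  have hNn : N < ⌊N⌋₊ + 1 := Nat.lt_floor_add_one N
  generalize ⌊N⌋₊ = n at hn hnN hNn
  have hn' : (1 : ℝ) ≤ n := by exact_mod_cast hn
  have hn0 : (0 : ℝ) < n := by linarith
  have hq0 : (0 : ℝ) < q := by exact_mod_cast hq
  have e2 : 1 / (n : ℝ) ^ ((1 : ℝ) / 2) ≤ 4 * (1 / N ^ ((1 : ℝ) / 2)) := by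
    rw [mul_one_div, div_le_div_iff₀ (by positivity) (by positivity), one_mul]
    calc N ^ ((1 : ℝ) / 2) ≤ (16 * (n : ℝ)) ^ ((1 : ℝ) / 2) := by
          gcongr
          linarith
      _ = 4 * (n : ℝ) ^ ((1 : ℝ) / 2) := by
        rw [Real.mul_rpow (by norm_num) hn0.le, ← Real.sqrt_eq_rpow 16,
          show (16 : ℝ) = 4 ^ 2 by norm_num, Real.sqrt_sq (by norm_num)]
  have e3 : (q : ℝ) / (n : ℝ) ^ 2 ≤ 4 * ((q : ℝ) / N ^ 2) := by
    rw [← mul_div_assoc, div_le_div_iff₀ (by positivity) (by positivity), mul_comm (4 : ℝ),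
      mul_assoc]
    gcongr
    nlinarith
  have e1 : 0 < 1 / (q : ℝ) := by positivity
  calc C * (n : ℝ) ^ (1 + ε) *
        (1 / (q : ℝ) + 1 / (n : ℝ) ^ ((1 : ℝ) / 2) + (q : ℝ) / (n : ℝ) ^ 2) ^ ((1 : ℝ) / 4)
      ≤ C * N ^ (1 + ε) *
        (4 * (1 / (q : ℝ) + 1 / N ^ ((1 : ℝ) / 2) + (q : ℝ) / N ^ 2)) ^ ((1 : ℝ) / 4) := by
        gcongr
        linarith
    _ = C * 4 ^ ((1 : ℝ) / 4) * N ^ (1 + ε) *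
        (1 / (q : ℝ) + 1 / N ^ ((1 : ℝ) / 2) + (q : ℝ) / N ^ 2) ^ ((1 : ℝ) / 4) := by
        rw [Real.mul_rpow (by norm_num) (by positivity)]
        ring
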